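/- For every u in X_A one has: ∫_{ℝ^N_*} |∇u|² dμ_A − ∫_{ℝ^N_*} |u − ∫_{ℝ^N_*} u dμ_A|² dμ_A ≥ (1/2) ∫_{ℝ^N_*} | u − ∫_{ℝ^N_*} u dμ_A + (∫_{ℝ^N_*} u x dμ_A) · (∫_{ℝ^N_*} x dμ_A) − (∫_{ℝ^N_*} u dμ_A) |∫_{ℝ^N_*} x dμ_A|² − (∫_{ℝ^N_*} u x dμ_A) · x + (∫_{ℝ^N_*} u dμ_A) (∫_{ℝ^N_*} x dμ_A) · x |² dμ_A, where ∫_{ℝ^N_*} u x dμ_A and ∫_{ℝ^N_*} x dμ_A denote the ℝ^N-valued integrals with components ∫ u x_j dμ_A and ∫ x_j dμ_A respectively. -/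

import Mathlib

open MeasureTheory Real

noncomputable section

/-- The Weyl chamber associated to the monomial weight with exponents `α`. -/
def chamber {N : ℕ} (α : Fin N → ℝ) : Set (EuclideanSpace ℝ (Fin N)) :=
  {x | ∀ i, 0 < α i → 0 < x i}

/-- The monomial weight `x^A = x₁^{α₁} ⋯ x_N^{α_N}`. -/
def monWeight {N : ℕ} (α : Fin N → ℝ) (x : EuclideanSpace ℝ (Fin N)) : ℝ :=
  ∏ i, x i ^ α i

/-- The monomial Gaussian probability measure
`dμ_A = x^A e^{-|x|²/2} dx / ∫_{ℝ^N_*} x^A e^{-|x|²/2} dx` on the Weyl chamber. -/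
def monGauss {N : ℕ} (α : Fin N → ℝ) : Measure (EuclideanSpace ℝ (Fin N)) :=
  (((MeasureTheory.volume.restrict (chamber α)).withDensity
      (fun x => ENNReal.ofReal (monWeight α x * Real.exp (-‖x‖ ^ 2 / 2)))) Set.univ)⁻¹ •
  ((MeasureTheory.volume.restrict (chamber α)).withDensity
      (fun x => ENNReal.ofReal (monWeight α x * Real.exp (-‖x‖ ^ 2 / 2))))

/-- Membership in the class `N_*`: smooth, compactly supported, with vanishing normal
component of the gradient on the boundary of the Weyl chamber. -/
def NstarClass {N : ℕ} (α : Fin N → ℝ) (u : EuclideanSpace ℝ (Fin N) → ℝ) : Prop :=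
  ContDiff ℝ (⊤ : ℕ∞) u ∧ HasCompactSupport u ∧
    ∀ x : EuclideanSpace ℝ (Fin N), ∀ i, 0 < α i → x i = 0 →
      fderiv ℝ u x (EuclideanSpace.single i 1) = 0

end

open Set Filter Topology

/-- `2t / (t² - s) · g(t)² · ρ(t)`: its derivative is bounded by `(g'² - 2g²) ρ` when `ρ` satisfies
`t ρ' = (s - 1 - t²) ρ`. It vanishes at the zeros of `t² - s`. -/
noncomputable def riccatiPrimitive (s : ℝ) (ρ g : ℝ → ℝ) (t : ℝ) : ℝ :=
  2 * t / (t ^ 2 - s) * g t ^ 2 * ρ t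

theorem continuousAt_riccatiPrimitive_zero {s a : ℝ} (has : a ^ 2 = s) (ha : a ≠ 0)
    {ρ g : ℝ → ℝ} (hρ : ContinuousAt ρ a) (hg : DifferentiableAt ℝ g a) (hga : g a = 0) :
    ContinuousAt (riccatiPrimitive s ρ g) a := by
  have hd : ContinuousAt (dslope g a) a := continuousAt_dslope_same.2 hg
  have hc : ContinuousAt
      (fun t => 2 * t / (t + a) * ((t - a) * dslope g a t ^ 2) * ρ t) a := by
    have h0 : a + a ≠ 0 := by
      intro h
      exact ha (by linarith)
    fun_prop (disch := assumption)
  have hev : ∀ᶠ t in 𝓝 a, t + a ≠ 0 := by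
    apply ContinuousAt.eventually_ne (by fun_prop)
    intro h
    exact ha (by linarith)
  refine hc.congr ?_
  filter_upwards [hev] with t ht
  have hgt : g t = (t - a) * dslope g a t := by
    have := sub_smul_dslope g a t
    rw [smul_eq_mul, hga, sub_zero] at this
    exact this.symm
  rw [riccatiPrimitive, hgt, ← has]
  rcases eq_or_ne t a with rfl | hta
  · simp
  · have h1 : t - a ≠ 0 := sub_ne_zero.2 hta
    have h2 : t ^ 2 - a ^ 2 ≠ 0 := by
      rw [sq_sub_sq]
      exact mul_ne_zero ht h1
    field_simp
    ring

theorem continuousAt_riccatiPrimitive {s a : ℝ} {ρ g : ℝ → ℝ} (hρ : ContinuousAt ρ a)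
    (hg : DifferentiableAt ℝ g a) (ha : a ^ 2 = s → a ≠ 0 ∧ g a = 0) :
    ContinuousAt (riccatiPrimitive s ρ g) a := by
  by_cases h : a ^ 2 = s
  · exact continuousAt_riccatiPrimitive_zero h (ha h).1 hρ hg (ha h).2
  · have hg' := hg.continuousAt
    have h' : a ^ 2 - s ≠ 0 := sub_ne_zero.2 h
    unfold riccatiPrimitive
    fun_prop (disch := assumption)

theorem riccatiPrimitive_sub_le {s p r : ℝ} (hpr : p ≤ r) {ρ ρ' g g' : ℝ → ℝ}
    (hρ : Continuous ρ) (hρ0 : ∀ t ∈ Ioo p r, 0 ≤ ρ t)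
    (hρ' : ∀ t ∈ Ioo p r, HasDerivAt ρ (ρ' t) t)
    (hρs : ∀ t ∈ Ioo p r, t * ρ' t = (s - 1 - t ^ 2) * ρ t)
    (hg : ∀ t, HasDerivAt g (g' t) t)
    (hs : ∀ t ∈ Ioo p r, t ^ 2 ≠ s)
    (hend : ∀ t, t ^ 2 = s → t ∈ Icc p r → t ≠ 0 ∧ g t = 0)
    (hInt : IntegrableOn (fun t => (g' t ^ 2 - 2 * g t ^ 2) * ρ t) (Icc p r)) :
    riccatiPrimitive s ρ g r - riccatiPrimitive s ρ g p ≤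
      ∫ t in p..r, (g' t ^ 2 - 2 * g t ^ 2) * ρ t := by
  let F' : ℝ → ℝ := fun t =>
    ((2 * (t ^ 2 - s) - 2 * t * (2 * t)) / (t ^ 2 - s) ^ 2 * g t ^ 2
      + 2 * t / (t ^ 2 - s) * (2 * g t * g' t)) * ρ t + 2 * t / (t ^ 2 - s) * g t ^ 2 * ρ' t
  refine intervalIntegral.sub_le_integral_of_hasDeriv_right_of_le (g' := F') hpr ?_ ?_ hInt ?_
  · intro t ht
    exact (continuousAt_riccatiPrimitive hρ.continuousAt (hg t).differentiableAt
      fun h => hend t h ht).continuousWithinAt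
  · intro t ht
    have h' : t ^ 2 - s ≠ 0 := sub_ne_zero.2 (hs t ht)
    have h1 : HasDerivAt (fun t : ℝ => 2 * t) 2 t := by
      simpa using (hasDerivAt_id t).const_mul 2
    have h2 : HasDerivAt (fun t : ℝ => t ^ 2 - s) (2 * t) t := by
      simpa using (hasDerivAt_pow 2 t).sub_const s
    have h3 : HasDerivAt (fun t : ℝ => g t ^ 2) (2 * g t * g' t) t := by
      simpa using (hg t).fun_pow 2
    exact (((h1.div h2 h').mul h3).mul (hρ' t ht)).hasDerivWithinAt
  · intro t ht
    have h' : t ^ 2 - s ≠ 0 := sub_ne_zero.2 (hs t ht)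
    have key : F' t = (g' t ^ 2 - 2 * g t ^ 2) * ρ t
        - (g' t - 2 * t / (t ^ 2 - s) * g t) ^ 2 * ρ t := by
      have e : 2 * t / (t ^ 2 - s) * g t ^ 2 * ρ' t =
          2 / (t ^ 2 - s) * g t ^ 2 * ((s - 1 - t ^ 2) * ρ t) := by
        rw [← hρs t ht]
        ring
      simp only [F']
      rw [e]
      field_simp
      ring
    rw [key]
    have := mul_nonneg (sq_nonneg (g' t - 2 * t / (t ^ 2 - s) * g t)) (hρ0 t ht)
    linarith

/-- Spectral gap `2` on the half-line, in terms of a function vanishing at the zero `√s` of the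
second eigenfunction. -/
theorem two_mul_setIntegral_Ioi_sq_le {s : ℝ} (hs : 0 < s) {ρ ρ' g g' : ℝ → ℝ}
    (hρ : Continuous ρ) (hρ0 : ∀ t, 0 < t → 0 ≤ ρ t)
    (hρ' : ∀ t, 0 < t → HasDerivAt ρ (ρ' t) t)
    (hρs : ∀ t, 0 < t → t * ρ' t = (s - 1 - t ^ 2) * ρ t)
    (hg : ∀ t, HasDerivAt g (g' t) t) (hgs : g (√s) = 0)
    (hInt : IntegrableOn (fun t => (g' t ^ 2 - 2 * g t ^ 2) * ρ t) (Ioi 0)) :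
    0 ≤ ∫ t in Ioi 0, (g' t ^ 2 - 2 * g t ^ 2) * ρ t := by
  have hs0 : 0 < √s := Real.sqrt_pos.2 hs
  have hss : √s ^ 2 = s := Real.sq_sqrt hs.le
  have hInt' : ∀ a b : ℝ, 0 ≤ a →
      IntegrableOn (fun t => (g' t ^ 2 - 2 * g t ^ 2) * ρ t) (Icc a b) := fun a b ha =>
    (integrableOn_Icc_iff_integrableOn_Ioc enorm_ne_top).2
      (hInt.mono_set (Ioc_subset_Ioi_self.trans (Ioi_subset_Ioi ha)))
  have hroot : ∀ t, 0 ≤ t → t ^ 2 = s → t = √s := fun t ht h => by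
    rw [← h, Real.sqrt_sq ht]
  refine ge_of_tendsto (intervalIntegral_tendsto_integral_Ioi 0 hInt tendsto_id) ?_
  filter_upwards [eventually_gt_atTop (√s)] with R hR
  have h1 := riccatiPrimitive_sub_le (s := s) hs0.le hρ (fun t ht => hρ0 t ht.1)
    (fun t ht => hρ' t ht.1) (fun t ht => hρs t ht.1) hg
    (fun t ht h => ht.2.ne (hroot t ht.1.le h))
    (fun t h ht => by rw [hroot t ht.1 h]; exact ⟨hs0.ne', hgs⟩) (hInt' 0 (√s) le_rfl)
  have h2 := riccatiPrimitive_sub_le (s := s) hR.le hρ (fun t ht => hρ0 t (hs0.trans ht.1))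
    (fun t ht => hρ' t (hs0.trans ht.1)) (fun t ht => hρs t (hs0.trans ht.1)) hg
    (fun t ht h => ht.1.ne' (hroot t (hs0.trans ht.1).le h))
    (fun t h ht => by rw [hroot t (hs0.le.trans ht.1) h]; exact ⟨hs0.ne', hgs⟩)
    (hInt' (√s) R hs0.le)
  have e1 : riccatiPrimitive s ρ g (√s) = 0 := by simp [riccatiPrimitive, hgs]
  have e0 : riccatiPrimitive s ρ g 0 = 0 := by simp [riccatiPrimitive]
  have eR : 0 ≤ riccatiPrimitive s ρ g R := by
    have hR0 := hs0.trans hR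
    have : s ≤ R ^ 2 := by rw [← hss]; gcongr
    have h4 := hρ0 R hR0
    have h5 : 0 ≤ R ^ 2 - s := by linarith
    unfold riccatiPrimitive
    positivity
  have hadd := intervalIntegral.integral_add_adjacent_intervals
    ((intervalIntegrable_iff_integrableOn_Icc_of_le hs0.le).2 (hInt' 0 (√s) le_rfl))
    ((intervalIntegrable_iff_integrableOn_Icc_of_le hR.le).2 (hInt' (√s) R hs0.le))
  simp only [id]
  linarith

/-- The Gaussian analogue on the line, for functions vanishing at both zeros `±1` of the second
Hermite polynomial. -/
theorem two_mul_integral_sq_le {ρ ρ' g g' : ℝ → ℝ}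
    (hρ0 : ∀ t, 0 ≤ ρ t) (hρ' : ∀ t, HasDerivAt ρ (ρ' t) t)
    (hρs : ∀ t, ρ' t = - t * ρ t)
    (hg : ∀ t, HasDerivAt g (g' t) t) (hg1 : g 1 = 0) (hg2 : g (-1) = 0)
    (hInt : Integrable (fun t => (g' t ^ 2 - 2 * g t ^ 2) * ρ t)) :
    0 ≤ ∫ t, (g' t ^ 2 - 2 * g t ^ 2) * ρ t := by
  have hρ : Continuous ρ := continuous_iff_continuousAt.2 fun t => (hρ' t).continuousAt
  have hroot : ∀ t : ℝ, t ^ 2 = 1 → t ≠ 0 ∧ g t = 0 := fun t h => by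
    rcases sq_eq_one_iff.1 h with rfl | rfl
    · exact ⟨by norm_num, hg1⟩
    · exact ⟨by norm_num, hg2⟩
  have key : ∀ p r : ℝ, p ≤ r → (∀ t ∈ Ioo p r, t ^ 2 ≠ 1) →
      riccatiPrimitive 1 ρ g r - riccatiPrimitive 1 ρ g p ≤
        ∫ t in p..r, (g' t ^ 2 - 2 * g t ^ 2) * ρ t := fun p r hpr h =>
    riccatiPrimitive_sub_le hpr hρ (fun t _ => hρ0 t) (fun t _ => hρ' t)
      (fun t _ => by rw [hρs]; ring) hg h (fun t h _ => hroot t h) hInt.integrableOn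
  refine ge_of_tendsto (intervalIntegral_tendsto_integral hInt tendsto_neg_atTop_atBot
    tendsto_id) ?_
  filter_upwards [eventually_gt_atTop (1 : ℝ)] with R hR
  have h1 := key (-R) (-1) (by linarith) (fun t ht h => by nlinarith [ht.1, ht.2])
  have h2 := key (-1) 1 (by norm_num) (fun t ht h => by nlinarith [ht.1, ht.2])
  have h3 := key 1 R hR.le (fun t ht h => by nlinarith [ht.1, ht.2])
  have e1 : riccatiPrimitive 1 ρ g 1 = 0 := by simp [riccatiPrimitive]
  have e2 : riccatiPrimitive 1 ρ g (-1) = 0 := by simp [riccatiPrimitive]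
  have h5 : 0 ≤ R ^ 2 - 1 := by nlinarith
  have e3 : 0 ≤ riccatiPrimitive 1 ρ g R := by
    have h4 := hρ0 R
    unfold riccatiPrimitive
    positivity
  have e4 : riccatiPrimitive 1 ρ g (-R) ≤ 0 := by
    have h4 := hρ0 (-R)
    have : 0 ≤ 2 * R / (R ^ 2 - 1) * g (-R) ^ 2 * ρ (-R) := by positivity
    unfold riccatiPrimitive
    rw [neg_sq, mul_neg, neg_div, neg_mul, neg_mul]
    linarith
  have i : ∀ a b : ℝ, IntervalIntegrable (fun t => (g' t ^ 2 - 2 * g t ^ 2) * ρ t) volume a b :=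
    fun a b => hInt.intervalIntegrable
  have hadd := intervalIntegral.integral_add_adjacent_intervals (i (-R) (-1)) (i (-1) 1)
  have hadd' := intervalIntegral.integral_add_adjacent_intervals (i (-R) 1) (i 1 R)
  simp only [id]
  linarith

section Tensor

variable {V ι : Type*} [AddCommGroup V] (q : V → ℝ) (E C P : ι → V →+ V)

/-- The form `2 (q - q ∘ E i) - q ∘ C i`. For an `IsCommutingSystem` its value relative to `q` is
`0`, `1`, `2` on the ranges of `E i`, `P i`, `1 - E i - P i` respectively. -/
def coordForm (i : ι) (u : V) : ℝ := 2 * q u - 2 * q (E i u) - q (C i u)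

/-- Apply successively the averages `E i` for `i` in the list. -/
def averageList : List ι → V → V
  | [], u => u
  | j :: l, u => averageList l (E j u)

/-- The total mass of the components along exactly one `C j`, averaged in all other indices of the
list. -/
def linearPart : List ι → V → ℝ
  | [], _ => 0
  | j :: l, u => linearPart l (E j u) + q (averageList E l (C j u))

/-- Averages `E i`, linear coefficients `C i` and linear components `P i` in each coordinate `i`,
splitting a nonnegative form `q`, and commuting for different coordinates. -/
structure IsCommutingSystem : Prop where
  nonneg : ∀ u, 0 ≤ q u
  split : ∀ i u, q u = q (E i u) + q (C i u) + q (u - E i u - P i u)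
  EE : ∀ i j, i ≠ j → ∀ u, E i (E j u) = E j (E i u)
  EC : ∀ i j, i ≠ j → ∀ u, E i (C j u) = C j (E i u)
  EP : ∀ i j, i ≠ j → ∀ u, E i (P j u) = P j (E i u)
  CC : ∀ i j, i ≠ j → ∀ u, C i (C j u) = C j (C i u)
  CP : ∀ i j, i ≠ j → ∀ u, C i (P j u) = P j (C i u)

namespace IsCommutingSystem

variable {q E C P}

theorem coordForm_nonneg (h : IsCommutingSystem q E C P) (i : ι) (u : V) :
    0 ≤ coordForm q E C i u := by
  have h1 := h.split i u
  have h2 := h.nonneg (C i u)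
  have h3 := h.nonneg (u - E i u - P i u)
  unfold coordForm
  linarith

theorem coordForm_add_le (h : IsCommutingSystem q E C P) {i j : ι} (hij : i ≠ j) (u : V) :
    coordForm q E C i (E j u) + coordForm q E C i (C j u) ≤ coordForm q E C i u := by
  have h0 := h.coordForm_nonneg i (u - E j u - P j u)
  have h1 := h.split j u
  have h2 := h.split j (E i u)
  have h3 := h.split j (C i u)
  unfold coordForm at *
  rw [map_sub, map_sub, map_sub, map_sub, h.EE i j hij, h.EP i j hij, ← h.EC j i hij.symm,
    h.CP i j hij] at h0
  rw [h.EE i j hij, h.EC i j hij, ← h.EC j i hij.symm, h.CC i j hij]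
  linarith

theorem sub_average_le_sum (h : IsCommutingSystem q E C P) {l : List ι} (hl : l.Nodup) (u : V) :
    q u - q (averageList E l u) ≤ (l.map fun i => coordForm q E C i u).sum := by
  induction l generalizing u with
  | nil => simp [averageList]
  | cons j l ih =>
    obtain ⟨hj, hl⟩ := List.nodup_cons.1 hl
    have h1 := ih hl (E j u)
    have h2 : (l.map fun i => coordForm q E C i (E j u)).sum ≤
        (l.map fun i => coordForm q E C i u).sum := by
      refine List.sum_le_sum fun i hi => ?_
      have := h.coordForm_add_le (i := i) (j := j) (fun e => hj (e ▸ hi)) u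
      linarith [h.coordForm_nonneg i (C j u)]
    have h3 := h.split j u
    have h4 := h.nonneg (C j u)
    have h5 := h.nonneg (u - E j u - P j u)
    simp only [List.map_cons, List.sum_cons, averageList]
    have h6 : coordForm q E C j u = 2 * q u - 2 * q (E j u) - q (C j u) := rfl
    linarith

theorem two_mul_sub_average_sub_linearPart_le_sum (h : IsCommutingSystem q E C P) {l : List ι}
    (hl : l.Nodup) (u : V) :
    2 * (q u - q (averageList E l u)) - linearPart q E C l u ≤
      (l.map fun i => coordForm q E C i u).sum := by
  induction l generalizing u with
  | nil => simp [averageList, linearPart]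
  | cons j l ih =>
    obtain ⟨hj, hl⟩ := List.nodup_cons.1 hl
    have h1 := ih hl (E j u)
    have h1' := h.sub_average_le_sum hl (C j u)
    have h2 : (l.map fun i => coordForm q E C i (E j u) + coordForm q E C i (C j u)).sum ≤
        (l.map fun i => coordForm q E C i u).sum :=
      List.sum_le_sum fun i hi =>
        h.coordForm_add_le (i := i) (j := j) (fun e => hj (e ▸ hi)) u
    rw [List.sum_map_add] at h2
    have h3 := h.split j u
    simp only [List.map_cons, List.sum_cons, averageList, linearPart]
    have h6 : coordForm q E C j u = 2 * q u - 2 * q (E j u) - q (C j u) := rfl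
    linarith

end IsCommutingSystem

end Tensor

section Product

variable {ι : Type*}

/-- Probability measures with finite second moment, together with functions of linear growth that
are centered and either normalized in `L²` or zero. -/
structure IsCoordSystem (ν : ι → Measure ℝ) (e : ι → ℝ → ℝ) : Prop where
  prob : ∀ i, IsProbabilityMeasure (ν i)
  moment : ∀ i, Integrable (fun t : ℝ => (1 + |t|) ^ 2) (ν i)
  meas : ∀ i, Measurable (e i)
  bound : ∀ i t, |e i t| ≤ 1 + |t|
  centered : ∀ i, ∫ t, e i t ∂ν i = 0
  normalized : ∀ i t, (∫ t, e i t ^ 2 ∂ν i) * e i t = e i t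

variable {ν : ι → Measure ℝ} {e : ι → ℝ → ℝ} {φ ψ : ℝ → ℝ}

theorem IsCoordSystem.integrable_of_bound (h : IsCoordSystem ν e) (i : ι)
    (hφ : Measurable φ) {K : ℝ} (hK : ∀ t, |φ t| ≤ K * (1 + |t|) ^ 2) : Integrable φ (ν i) :=
  ((h.moment i).const_mul K).mono' hφ.aestronglyMeasurable (ae_of_all _ hK)

/-- Measurable functions of at most linear growth in each coordinate. -/
def growthSpace (ι : Type*) [Fintype ι] : AddSubgroup ((ι → ℝ) → ℝ) where
  carrier := {f | Measurable f ∧ ∃ K : ℝ, 0 ≤ K ∧ ∀ x, |f x| ≤ K * ∏ k, (1 + |x k|)}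
  zero_mem' := ⟨measurable_const, 0, le_rfl, by simp⟩
  add_mem' := by
    rintro f g ⟨hf, K, hK, hfK⟩ ⟨hg, L, hL, hgL⟩
    refine ⟨hf.add hg, K + L, by positivity, fun x => (abs_add_le _ _).trans ?_⟩
    rw [add_mul]
    exact add_le_add (hfK x) (hgL x)
  neg_mem' := by
    rintro f ⟨hf, K, hK, hfK⟩
    exact ⟨hf.neg, K, hK, fun x => by simpa using hfK x⟩

variable [Fintype ι] [DecidableEq ι]

theorem prod_one_add_abs_update (x : ι → ℝ) (i : ι) (t : ℝ) :
    ∏ k, (1 + |Function.update x i t k|) =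
      (1 + |t|) * ∏ k ∈ Finset.univ.erase i, (1 + |x k|) := by
  rw [← Finset.mul_prod_erase _ _ (Finset.mem_univ i), Function.update_self]
  congr 1
  refine Finset.prod_congr rfl fun k hk => ?_
  rw [Function.update_of_ne (Finset.ne_of_mem_erase hk)]

theorem prod_erase_one_add_abs_le (x : ι → ℝ) (i : ι) :
    ∏ k ∈ Finset.univ.erase i, (1 + |x k|) ≤ ∏ k, (1 + |x k|) := by
  rw [← Finset.mul_prod_erase Finset.univ _ (Finset.mem_univ i)]
  exact le_mul_of_one_le_left (Finset.prod_nonneg fun k _ => by positivity)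
    (by linarith [abs_nonneg (x i)])

namespace IsCoordSystem

omit [Fintype ι] in
theorem measurable_slice {f : (ι → ℝ) → ℝ} (hf : Measurable f) (i : ι) (x : ι → ℝ) :
    Measurable fun t => f (Function.update x i t) :=
  hf.comp (measurable_update x)

theorem abs_slice_mul_le {f : (ι → ℝ) → ℝ} {K : ℝ}
    (hfK : ∀ x, |f x| ≤ K * ∏ k, (1 + |x k|)) (i : ι) (hb : ∀ t, |φ t| ≤ 1 + |t|) (x : ι → ℝ)
    (t : ℝ) :
    |f (Function.update x i t) * φ t| ≤
      (K * ∏ k ∈ Finset.univ.erase i, (1 + |x k|)) * (1 + |t|) ^ 2 := by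
  have h1 := hfK (Function.update x i t)
  rw [prod_one_add_abs_update] at h1
  rw [abs_mul]
  calc _ ≤ K * ((1 + |t|) * ∏ k ∈ Finset.univ.erase i, (1 + |x k|)) * (1 + |t|) :=
        mul_le_mul h1 (hb t) (abs_nonneg _) ((abs_nonneg _).trans h1)
    _ = _ := by ring

theorem integrable_slice_mul (h : IsCoordSystem ν e) (f : growthSpace ι) (i : ι)
    (hφ : Measurable φ) (hb : ∀ t, |φ t| ≤ 1 + |t|) (x : ι → ℝ) :
    Integrable (fun t => f.1 (Function.update x i t) * φ t) (ν i) := by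
  obtain ⟨hf, K, hK, hfK⟩ := f.2
  exact h.integrable_of_bound i ((measurable_slice hf i x).mul hφ) (abs_slice_mul_le hfK i hb x)

theorem abs_integral_slice_mul_le (h : IsCoordSystem ν e) {f : (ι → ℝ) → ℝ} {K : ℝ}
    (hfK : ∀ x, |f x| ≤ K * ∏ k, (1 + |x k|)) (i : ι) (hb : ∀ t, |φ t| ≤ 1 + |t|) (x : ι → ℝ) :
    |∫ t, f (Function.update x i t) * φ t ∂ν i| ≤
      K * (∫ t, (1 + |t|) ^ 2 ∂ν i) * ∏ k ∈ Finset.univ.erase i, (1 + |x k|) := by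
  have h1 := norm_integral_le_of_norm_le ((h.moment i).const_mul _)
    (f := fun t => f (Function.update x i t) * φ t) (ae_of_all _ (abs_slice_mul_le hfK i hb x))
  rw [integral_const_mul] at h1
  exact h1.trans_eq (by ring)

omit [Fintype ι] in
theorem measurable_integral_slice_mul (h : IsCoordSystem ν e) {f : (ι → ℝ) → ℝ}
    (hf : Measurable f) (i : ι) (hφ : Measurable φ) :
    Measurable fun x => ∫ t, f (Function.update x i t) * φ t ∂ν i := by
  have := h.prob i
  have h1 : Measurable fun p : (ι → ℝ) × ℝ => f (Function.update p.1 i p.2) * φ p.2 :=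
    (hf.comp (measurable_update')).mul (hφ.comp measurable_snd)
  exact h1.stronglyMeasurable.integral_prod_right'.measurable

/-- Integration in the coordinate `i` against `φ`. -/
noncomputable def partialIntegral (h : IsCoordSystem ν e) (i : ι) (hφ : Measurable φ)
    (hb : ∀ t, |φ t| ≤ 1 + |t|) : growthSpace ι →+ growthSpace ι :=
  AddMonoidHom.mk' (fun f => ⟨fun x => ∫ t, f.1 (Function.update x i t) * φ t ∂ν i, by
    obtain ⟨hf, K, hK, hfK⟩ := f.2
    have hI : 0 ≤ ∫ t, (1 + |t|) ^ 2 ∂ν i := integral_nonneg fun t => by positivity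
    exact ⟨h.measurable_integral_slice_mul hf i hφ, K * ∫ t, (1 + |t|) ^ 2 ∂ν i, by positivity,
      fun x => (h.abs_integral_slice_mul_le hfK i hb x).trans
        (mul_le_mul_of_nonneg_left (prod_erase_one_add_abs_le x i) (by positivity))⟩⟩) (by
    intro f g
    ext x
    change ∫ t, (f.1 _ + g.1 _) * φ t ∂ν i = _ + _
    rw [← integral_add (h.integrable_slice_mul f i hφ hb x) (h.integrable_slice_mul g i hφ hb x)]
    simp only [add_mul])

/-- Average in the coordinate `i`. -/
noncomputable def average (h : IsCoordSystem ν e) (i : ι) : growthSpace ι →+ growthSpace ι :=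
  h.partialIntegral i (φ := fun _ => 1) measurable_const (by simp)

/-- The coefficient of `e i` in the coordinate `i`. -/
noncomputable def coefficient (h : IsCoordSystem ν e) (i : ι) : growthSpace ι →+ growthSpace ι :=
  h.partialIntegral i (h.meas i) (h.bound i)

/-- The component along `e i` in the coordinate `i`. -/
noncomputable def component (h : IsCoordSystem ν e) (i : ι) : growthSpace ι →+ growthSpace ι :=
  AddMonoidHom.mk' (fun f => ⟨fun x => e i (x i) * (h.coefficient i f).1 x, by
    obtain ⟨hf, K, hK, hfK⟩ := f.2
    have hI : 0 ≤ ∫ t, (1 + |t|) ^ 2 ∂ν i := integral_nonneg fun t => by positivity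
    refine ⟨((h.meas i).comp (measurable_pi_apply i)).mul (h.coefficient i f).2.1,
      K * ∫ t, (1 + |t|) ^ 2 ∂ν i, by positivity, fun x => ?_⟩
    rw [abs_mul, ← Finset.mul_prod_erase _ _ (Finset.mem_univ i)]
    calc _ ≤ (1 + |x i|) * (K * (∫ t, (1 + |t|) ^ 2 ∂ν i) *
          ∏ k ∈ Finset.univ.erase i, (1 + |x k|)) :=
        mul_le_mul (h.bound i _) (h.abs_integral_slice_mul_le hfK i (h.bound i) x)
          (abs_nonneg _) (by positivity)
      _ = _ := by ring⟩) (by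
    intro f g
    ext x
    change e i (x i) * (h.coefficient i (f + g)).1 x = _ + _
    rw [map_add]
    exact mul_add _ _ _)

theorem average_apply (h : IsCoordSystem ν e) (i : ι) (f : growthSpace ι) (x : ι → ℝ) :
    (h.average i f).1 x = ∫ t, f.1 (Function.update x i t) ∂ν i := by
  change ∫ t, f.1 (Function.update x i t) * 1 ∂ν i = _
  simp only [mul_one]

theorem coefficient_apply (h : IsCoordSystem ν e) (i : ι) (f : growthSpace ι) (x : ι → ℝ) :
    (h.coefficient i f).1 x = ∫ t, f.1 (Function.update x i t) * e i t ∂ν i := rfl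

theorem component_apply (h : IsCoordSystem ν e) (i : ι) (f : growthSpace ι) (x : ι → ℝ) :
    (h.component i f).1 x = e i (x i) * (h.coefficient i f).1 x := rfl

theorem partialIntegral_comm (h : IsCoordSystem ν e) {i j : ι} (hij : i ≠ j) (hφ : Measurable φ)
    (hbφ : ∀ t, |φ t| ≤ 1 + |t|) (hψ : Measurable ψ) (hbψ : ∀ t, |ψ t| ≤ 1 + |t|)
    (f : growthSpace ι) :
    h.partialIntegral i hφ hbφ (h.partialIntegral j hψ hbψ f) =
      h.partialIntegral j hψ hbψ (h.partialIntegral i hφ hbφ f) := by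
  have := h.prob i
  have := h.prob j
  ext x
  change ∫ t, (∫ s, f.1 (Function.update (Function.update x i t) j s) * ψ s ∂ν j) * φ t ∂ν i =
    ∫ s, (∫ t, f.1 (Function.update (Function.update x j s) i t) * φ t ∂ν i) * ψ s ∂ν j
  simp_rw [← integral_mul_const]
  rw [integral_integral_swap]
  · refine integral_congr_ae (ae_of_all _ fun s => integral_congr_ae (ae_of_all _ fun t => ?_))
    simp only
    rw [Function.update_comm hij]
    ring
  · obtain ⟨hf, K, hK, hfK⟩ := f.2
    have hm : Measurable fun p : ℝ × ℝ => Function.update (Function.update x i p.1) j p.2 :=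
      (measurable_update').comp
        (((measurable_update x).comp measurable_fst).prodMk measurable_snd)
    refine (((h.moment i).mul_prod (h.moment j)).const_mul (K * ∏ k, (1 + |x k|))).mono'
      (((hf.comp hm).mul (hψ.comp measurable_snd)).mul
        (hφ.comp measurable_fst)).aestronglyMeasurable (ae_of_all _ fun p => ?_)
    have h1 := hfK (Function.update (Function.update x i p.1) j p.2)
    rw [prod_one_add_abs_update] at h1
    have h2 := prod_erase_one_add_abs_le (Function.update x i p.1) j
    rw [prod_one_add_abs_update] at h2
    have h3 := prod_erase_one_add_abs_le x i
    simp only [Function.uncurry, Real.norm_eq_abs, abs_mul]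
    have h4 : |f.1 (Function.update (Function.update x i p.1) j p.2)| ≤
        K * ((1 + |p.2|) * ((1 + |p.1|) * ∏ k, (1 + |x k|))) := by
      refine h1.trans ?_
      gcongr
      exact h2.trans (by gcongr)
    calc _ ≤ K * ((1 + |p.2|) * ((1 + |p.1|) * ∏ k, (1 + |x k|))) * (1 + |p.2|) * (1 + |p.1|) := by
          gcongr
          · exact hbψ _
          · exact hbφ _
      _ = _ := by ring

theorem partialIntegral_component (h : IsCoordSystem ν e) {i j : ι} (hij : i ≠ j)
    (hφ : Measurable φ) (hb : ∀ t, |φ t| ≤ 1 + |t|) (f : growthSpace ι) :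
    h.partialIntegral i hφ hb (h.component j f) = h.component j (h.partialIntegral i hφ hb f) := by
  ext x
  rw [component_apply]
  have hc := congrArg (fun g : growthSpace ι => g.1 x)
    (h.partialIntegral_comm hij hφ hb (h.meas j) (h.bound j) f)
  change _ = (h.coefficient j (h.partialIntegral i hφ hb f)).1 x at hc
  rw [← hc]
  change ∫ t, e j (Function.update x i t j) *
    (h.coefficient j f).1 (Function.update x i t) * φ t ∂ν i =
    e j (x j) * ∫ t, (h.coefficient j f).1 (Function.update x i t) * φ t ∂ν i
  simp_rw [Function.update_of_ne hij.symm, mul_assoc, integral_const_mul]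

theorem measurePreserving_update (h : IsCoordSystem ν e) (i : ι) :
    MeasurePreserving (fun p : (ι → ℝ) × ℝ => Function.update p.1 i p.2)
      ((Measure.pi ν).prod (ν i)) (Measure.pi ν) := by
  have := h.prob
  refine ⟨measurable_update', (Measure.pi_eq fun s hs => ?_).symm⟩
  rw [Measure.map_apply measurable_update' (MeasurableSet.univ_pi hs)]
  have hpre : (fun p : (ι → ℝ) × ℝ => Function.update p.1 i p.2) ⁻¹' (univ.pi s) =
      (univ.pi (Function.update s i univ)) ×ˢ s i := by
    ext ⟨x, t⟩
    simp only [mem_preimage, mem_univ_pi, mem_prod]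
    constructor
    · intro hx
      refine ⟨fun k => ?_, by simpa using hx i⟩
      rcases eq_or_ne k i with rfl | hk
      · simp
      · simpa [hk] using hx k
    · rintro ⟨hx, ht⟩ k
      rcases eq_or_ne k i with rfl | hk
      · simpa using ht
      · simpa [hk] using hx k
  rw [hpre, Measure.prod_prod, Measure.pi_pi, ← Finset.mul_prod_erase _ _ (Finset.mem_univ i),
    ← Finset.mul_prod_erase Finset.univ (fun k => ν k (s k)) (Finset.mem_univ i),
    Function.update_self, measure_univ, one_mul, mul_comm]
  congr 1
  refine Finset.prod_congr rfl fun k hk => ?_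
  rw [Function.update_of_ne (Finset.ne_of_mem_erase hk)]

theorem integrable_integral_slice (h : IsCoordSystem ν e) (i : ι) {F : (ι → ℝ) → ℝ}
    (hF : Integrable F (Measure.pi ν)) :
    Integrable (fun x => ∫ t, F (Function.update x i t) ∂ν i) (Measure.pi ν) := by
  have := h.prob
  exact ((h.measurePreserving_update i).integrable_comp_of_integrable hF).integral_prod_left

theorem integral_integral_slice (h : IsCoordSystem ν e) (i : ι) {F : (ι → ℝ) → ℝ}
    (hF : Integrable F (Measure.pi ν)) :
    ∫ x, ∫ t, F (Function.update x i t) ∂ν i ∂Measure.pi ν = ∫ x, F x ∂Measure.pi ν := by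
  have := h.prob
  have hp := h.measurePreserving_update i
  have h1 := integral_prod _ (hp.integrable_comp_of_integrable hF)
  have h2 := integral_map hp.measurable.aemeasurable (f := F)
    (hp.map_eq.symm ▸ hF.aestronglyMeasurable)
  rw [hp.map_eq] at h2
  rw [h2]
  exact h1.symm

omit [DecidableEq ι] in
theorem integrable_mul (h : IsCoordSystem ν e) (f g : growthSpace ι) :
    Integrable (fun x => f.1 x * g.1 x) (Measure.pi ν) := by
  have := h.prob
  obtain ⟨hf, K, hK, hfK⟩ := f.2
  obtain ⟨hg, L, hL, hgL⟩ := g.2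
  refine ((Integrable.fintype_prod fun k => h.moment k).const_mul (K * L)).mono'
    (hf.mul hg).aestronglyMeasurable (ae_of_all _ fun x => ?_)
  rw [Real.norm_eq_abs, abs_mul]
  refine (mul_le_mul (hfK x) (hgL x) (abs_nonneg _) ((abs_nonneg _).trans (hfK x))).trans_eq ?_
  rw [Finset.prod_pow]
  ring

omit [DecidableEq ι] in
theorem integrable_sq (h : IsCoordSystem ν e) (f : growthSpace ι) :
    Integrable (fun x => f.1 x ^ 2) (Measure.pi ν) := by
  simpa only [sq] using h.integrable_mul f f

omit [DecidableEq ι] [Fintype ι] in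
theorem one_le_prod_one_add_abs (s : Finset ι) (x : ι → ℝ) : 1 ≤ ∏ k ∈ s, (1 + |x k|) := by
  refine (Finset.prod_const_one (s := s)).symm.trans_le
    (Finset.prod_le_prod (fun _ _ => zero_le_one) fun k _ => ?_)
  linarith [abs_nonneg (x k)]

omit [DecidableEq ι] in
theorem one_mem_growthSpace : (fun _ => 1 : (ι → ℝ) → ℝ) ∈ growthSpace ι :=
  ⟨measurable_const, 1, zero_le_one, fun x => by
    rw [abs_one, one_mul]
    exact one_le_prod_one_add_abs _ x⟩

theorem coord_mem_growthSpace {i : ι} (hφ : Measurable φ) (hb : ∀ t, |φ t| ≤ 1 + |t|) :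
    (fun x => φ (x i) : (ι → ℝ) → ℝ) ∈ growthSpace ι := by
  refine ⟨hφ.comp (measurable_pi_apply i), 1, zero_le_one, fun x => (hb _).trans ?_⟩
  rw [one_mul, ← Finset.mul_prod_erase _ _ (Finset.mem_univ i)]
  exact le_mul_of_one_le_right (by positivity) (one_le_prod_one_add_abs _ x)

omit [DecidableEq ι] in
theorem integrable (h : IsCoordSystem ν e) (f : growthSpace ι) :
    Integrable (fun x => f.1 x) (Measure.pi ν) := by
  simpa using h.integrable_mul f ⟨_, one_mem_growthSpace⟩

theorem integral_slice_sq (h : IsCoordSystem ν e) (i : ι) (f : growthSpace ι) (x : ι → ℝ) :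
    ∫ t, f.1 (Function.update x i t) ^ 2 ∂ν i = (h.average i f).1 x ^ 2
      + (h.coefficient i f).1 x ^ 2
      + ∫ t, (f - h.average i f - h.component i f).1 (Function.update x i t) ^ 2 ∂ν i := by
  have := h.prob i
  set a := (h.average i f).1 x with ha
  set c := (h.coefficient i f).1 x with hc
  have hsub : ∀ t, (f - h.average i f - h.component i f).1 (Function.update x i t) =
      f.1 (Function.update x i t) - a - e i t * c := fun t => by
    change f.1 _ - (h.average i f).1 _ - (h.component i f).1 _ = _
    rw [component_apply, average_apply, coefficient_apply, ha, hc, average_apply,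
      coefficient_apply]
    simp only [Function.update_idem, Function.update_self]
  have hone : Integrable (fun t => f.1 (Function.update x i t)) (ν i) := by
    simpa using h.integrable_slice_mul f i (φ := fun _ => 1) measurable_const (by simp) x
  have he := h.integrable_slice_mul f i (h.meas i) (h.bound i) x
  have hsq : Integrable (fun t => f.1 (Function.update x i t) ^ 2) (ν i) := by
    obtain ⟨hf, K, hK, hfK⟩ := f.2
    refine h.integrable_of_bound i ((measurable_slice hf i x).pow_const 2)
      (K := (K * ∏ k ∈ Finset.univ.erase i, (1 + |x k|)) ^ 2) fun t => ?_
    have h1 := hfK (Function.update x i t)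
    rw [prod_one_add_abs_update] at h1
    rw [abs_pow, ← mul_pow]
    refine pow_le_pow_left₀ (abs_nonneg _) (h1.trans_eq (by ring)) 2
  have he1 : Integrable (e i) (ν i) := by
    refine h.integrable_of_bound i (h.meas i) (K := 1) fun t => ?_
    nlinarith [h.bound i t, abs_nonneg t]
  have he2 : Integrable (fun t => e i t ^ 2) (ν i) := by
    refine h.integrable_of_bound i ((h.meas i).pow_const 2) (K := 1) fun t => ?_
    rw [abs_pow, one_mul]
    exact pow_le_pow_left₀ (abs_nonneg _) (h.bound i t) 2
  have hnorm : (∫ t, e i t ^ 2 ∂ν i) * c = c := by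
    rw [hc, coefficient_apply, ← integral_const_mul]
    refine integral_congr_ae (ae_of_all _ fun t => ?_)
    simp only
    rw [mul_left_comm, h.normalized]
  have hexp : ∫ t, (f.1 (Function.update x i t) - a - e i t * c) ^ 2 ∂ν i =
      (∫ t, f.1 (Function.update x i t) ^ 2 ∂ν i) - 2 * a * a + a ^ 2 - 2 * c * c
        + c ^ 2 * ∫ t, e i t ^ 2 ∂ν i := by
    have ha' : ∫ t, f.1 (Function.update x i t) ∂ν i = a := by rw [ha, average_apply]
    have hc' : ∫ t, f.1 (Function.update x i t) * e i t ∂ν i = c := rfl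
    have hpt : ∀ t, (f.1 (Function.update x i t) - a - e i t * c) ^ 2 =
        f.1 (Function.update x i t) ^ 2 + (-2 * a) * f.1 (Function.update x i t) + a ^ 2
          + (-2 * c) * (f.1 (Function.update x i t) * e i t) + (2 * a * c) * e i t
          + c ^ 2 * e i t ^ 2 := fun t => by ring
    simp_rw [hpt]
    have i2 := hsq.add (hone.const_mul (-2 * a))
    have i3 := i2.add (integrable_const (a ^ 2))
    have i4 := i3.add (he.const_mul (-2 * c))
    have i5 := i4.add (he1.const_mul (2 * a * c))
    rw [integral_add (by exact i5) (he2.const_mul _),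
      integral_add (by exact i4) (he1.const_mul _), integral_add (by exact i3) (he.const_mul _),
      integral_add (by exact i2) (integrable_const _), integral_add hsq (hone.const_mul _)]
    simp only [integral_const_mul, integral_const, probReal_univ, h.centered, ha', hc', one_smul]
    ring
  simp_rw [hsub]
  rw [hexp]
  linear_combination (-c) * hnorm

theorem isCommutingSystem (h : IsCoordSystem ν e) :
    IsCommutingSystem (fun f : growthSpace ι => ∫ x, f.1 x ^ 2 ∂Measure.pi ν)
      h.average h.coefficient h.component where
  nonneg u := integral_nonneg fun x => sq_nonneg _
  split i u := by
    rw [← h.integral_integral_slice i (h.integrable_sq u),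
      ← h.integral_integral_slice i (h.integrable_sq (u - h.average i u - h.component i u)),
      ← integral_add (h.integrable_sq _) (h.integrable_sq _)]
    exact (integral_congr_ae (ae_of_all _ fun x => h.integral_slice_sq i u x)).trans
      (integral_add ((h.integrable_sq _).add (h.integrable_sq _))
        (h.integrable_integral_slice i (h.integrable_sq _)))
  EE i j hij u := h.partialIntegral_comm hij _ _ _ _ u
  EC i j hij u := h.partialIntegral_comm hij _ _ _ _ u
  EP i j hij u := h.partialIntegral_component hij _ _ u
  CC i j hij u := h.partialIntegral_comm hij _ _ _ _ u
  CP i j hij u := h.partialIntegral_component hij _ _ u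

theorem integral_average_mul (h : IsCoordSystem ν e) (j : ι) (f g : growthSpace ι)
    (hg : ∀ x t, g.1 (Function.update x j t) = g.1 x) :
    ∫ x, (h.average j f).1 x * g.1 x ∂Measure.pi ν = ∫ x, f.1 x * g.1 x ∂Measure.pi ν := by
  rw [← h.integral_integral_slice j (h.integrable_mul f g)]
  refine integral_congr_ae (ae_of_all _ fun x => ?_)
  simp only [hg, average_apply, integral_mul_const]

theorem integral_average (h : IsCoordSystem ν e) (j : ι) (f : growthSpace ι) :
    ∫ x, (h.average j f).1 x ∂Measure.pi ν = ∫ x, f.1 x ∂Measure.pi ν := by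
  simpa using h.integral_average_mul j f ⟨_, one_mem_growthSpace⟩ fun _ _ => rfl

theorem integral_coefficient (h : IsCoordSystem ν e) (j : ι) (f : growthSpace ι) :
    ∫ x, (h.coefficient j f).1 x ∂Measure.pi ν = ∫ x, f.1 x * e j (x j) ∂Measure.pi ν := by
  have hInt := h.integrable_mul f ⟨_, coord_mem_growthSpace (i := j) (h.meas j) (h.bound j)⟩
  rw [← h.integral_integral_slice j hInt]
  refine integral_congr_ae (ae_of_all _ fun x => ?_)
  simp only [coefficient_apply, Function.update_self]

theorem partialIntegral_congr (h : IsCoordSystem ν e) {l : List ι} {j : ι} {f : growthSpace ι}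
    (hf : ∀ x y : ι → ℝ, (∀ i ∈ j :: l, x i = y i) → f.1 x = f.1 y) (hφ : Measurable φ)
    (hb : ∀ t, |φ t| ≤ 1 + |t|) (x y : ι → ℝ) (hxy : ∀ i ∈ l, x i = y i) :
    (h.partialIntegral j hφ hb f).1 x = (h.partialIntegral j hφ hb f).1 y := by
  change ∫ t, f.1 (Function.update x j t) * φ t ∂ν j = ∫ t, f.1 (Function.update y j t) * φ t ∂ν j
  refine integral_congr_ae (ae_of_all _ fun t => ?_)
  simp only
  rw [hf (Function.update x j t) (Function.update y j t)]
  intro i hi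
  rcases eq_or_ne i j with rfl | hij
  · simp
  · simpa [hij] using hxy i (List.mem_of_ne_of_mem hij hi)

theorem averageList_apply (h : IsCoordSystem ν e) {l : List ι} (f : growthSpace ι)
    (hf : ∀ x y : ι → ℝ, (∀ i ∈ l, x i = y i) → f.1 x = f.1 y) (x : ι → ℝ) :
    (averageList h.average l f).1 x = ∫ y, f.1 y ∂Measure.pi ν := by
  have := h.prob
  induction l generalizing f with
  | nil =>
    rw [integral_congr_ae (ae_of_all _ fun y => hf y x (by simp))]
    simp [averageList]
  | cons j l ih =>
    rw [averageList, ih (h.average j f) (h.partialIntegral_congr hf measurable_const (by simp)),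
      h.integral_average]

theorem linearPart_eq_sum (h : IsCoordSystem ν e) {l : List ι} (hl : l.Nodup) (f : growthSpace ι)
    (hf : ∀ x y : ι → ℝ, (∀ i ∈ l, x i = y i) → f.1 x = f.1 y) :
    linearPart (fun f : growthSpace ι => ∫ x, f.1 x ^ 2 ∂Measure.pi ν) h.average h.coefficient l f =
      (l.map fun i => (∫ x, f.1 x * e i (x i) ∂Measure.pi ν) ^ 2).sum := by
  have := h.prob
  induction l generalizing f with
  | nil => simp [linearPart]
  | cons j l ih =>
    obtain ⟨hj, hl⟩ := List.nodup_cons.1 hl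
    rw [linearPart, ih hl (h.average j f) (h.partialIntegral_congr hf measurable_const (by simp)),
      List.map_cons, List.sum_cons, add_comm]
    congr 1
    · simp_rw [h.averageList_apply (h.coefficient j f)
        (h.partialIntegral_congr hf (h.meas j) (h.bound j))]
      rw [integral_const, probReal_univ, one_smul, h.integral_coefficient]
    · congr 1
      refine List.map_congr_left fun i hi => ?_
      have hij : i ≠ j := fun e => hj (e ▸ hi)
      have := h.integral_average_mul j f
        ⟨_, coord_mem_growthSpace (i := i) (h.meas i) (h.bound i)⟩ (fun x t => by
          simp only [Function.update_of_ne hij])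
      simp only at this
      rw [this]

/-- Tensorization of the one-dimensional spectral inequalities. -/
theorem two_mul_variance_sub_le (h : IsCoordSystem ν e) (f : growthSpace ι) (g : ι → growthSpace ι)
    (hfg : ∀ i x, 2 * ∫ t, f.1 (Function.update x i t) ^ 2 ∂ν i
        - 2 * (∫ t, f.1 (Function.update x i t) ∂ν i) ^ 2
        - (∫ t, f.1 (Function.update x i t) * e i t ∂ν i) ^ 2 ≤
      ∫ t, (g i).1 (Function.update x i t) ^ 2 ∂ν i) :
    2 * (∫ x, f.1 x ^ 2 ∂Measure.pi ν - (∫ x, f.1 x ∂Measure.pi ν) ^ 2)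
        - ∑ i, (∫ x, f.1 x * e i (x i) ∂Measure.pi ν) ^ 2 ≤
      ∑ i, ∫ x, (g i).1 x ^ 2 ∂Measure.pi ν := by
  have := h.prob
  have hf : ∀ x y : ι → ℝ, (∀ i ∈ Finset.univ.toList, x i = y i) → f.1 x = f.1 y :=
    fun x y hxy => congrArg f.1 (funext fun i => hxy i (by simp))
  have key := h.isCommutingSystem.two_mul_sub_average_sub_linearPart_le_sum
    (Finset.nodup_toList Finset.univ) f
  rw [h.linearPart_eq_sum (Finset.nodup_toList _) f hf, Finset.sum_map_toList,
    Finset.sum_map_toList] at key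
  simp_rw [h.averageList_apply f hf] at key
  rw [integral_const, probReal_univ, one_smul] at key
  refine key.trans (Finset.sum_le_sum fun i _ => ?_)
  have i1 := (h.integrable_integral_slice i (h.integrable_sq f)).const_mul 2
  have i2 := (h.integrable_sq (h.average i f)).const_mul 2
  have i3 := h.integrable_sq (h.coefficient i f)
  have hsub := integral_sub (i1.sub i2) i3
  have hsub' := integral_sub i1 i2
  have hmono := integral_mono ((i1.sub i2).sub i3)
    (h.integrable_integral_slice i (h.integrable_sq (g i))) fun x => by
      simp only [Pi.sub_apply, h.average_apply]
      exact hfg i x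
  simp only [Pi.sub_apply, integral_const_mul] at hsub hsub' hmono
  rw [h.integral_integral_slice i (h.integrable_sq f)] at hsub'
  rw [h.integral_integral_slice i (h.integrable_sq (g i))] at hmono
  change 2 * ∫ x, f.1 x ^ 2 ∂Measure.pi ν - 2 * ∫ x, (h.average i f).1 x ^ 2 ∂Measure.pi ν
    - ∫ x, (h.coefficient i f).1 x ^ 2 ∂Measure.pi ν ≤ _
  linarith

end IsCoordSystem

end Product

section OneDimensional

/-- The one-dimensional weight `|t| ^ a * exp (-t ^ 2 / 2)`. -/
noncomputable def coordDensity (a t : ℝ) : ℝ := |t| ^ a * Real.exp (-t ^ 2 / 2)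

/-- The half-line if `a` is positive, and the line otherwise. -/
def coordSet (a : ℝ) : Set ℝ := {t | 0 < a → 0 < t}

/-- The measure with density `coordDensity a` on `coordSet a`. -/
noncomputable def coordMass (a : ℝ) : Measure ℝ :=
  (volume.restrict (coordSet a)).withDensity fun t => ENNReal.ofReal (coordDensity a t)

/-- The probability measure proportional to `coordMass a`. -/
noncomputable def coordGauss (a : ℝ) : Measure ℝ := (coordMass a univ)⁻¹ • coordMass a

/-- The coordinate function in the Gaussian case `a = 0`, and `0` otherwise. -/
noncomputable def coordFun (a t : ℝ) : ℝ := if a = 0 then t else 0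

variable {a : ℝ}

theorem coordSet_zero : coordSet 0 = univ := by simp [coordSet]

theorem coordSet_of_pos (ha : 0 < a) : coordSet a = Ioi 0 := by
  ext t
  simp [coordSet, ha]

theorem measurableSet_coordSet (a : ℝ) : MeasurableSet (coordSet a) := by
  by_cases ha : 0 < a
  · rw [coordSet_of_pos ha]
    exact measurableSet_Ioi
  · simp [coordSet, ha]

theorem coordDensity_nonneg (a t : ℝ) : 0 ≤ coordDensity a t := by
  unfold coordDensity
  positivity

theorem continuous_coordDensity (ha : 0 ≤ a) : Continuous (coordDensity a) := by
  unfold coordDensity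
  exact (continuous_abs.rpow_const fun _ => Or.inr ha).mul (by fun_prop)

theorem coordDensity_eq_rpow {t : ℝ} (ha : 0 ≤ a) (ht : t ∈ coordSet a) :
    coordDensity a t = t ^ a * Real.exp (-(1 / 2) * t ^ 2) ∧
      t ^ 2 * coordDensity a t = t ^ (a + 2) * Real.exp (-(1 / 2) * t ^ 2) := by
  have hexp : -t ^ 2 / 2 = -(1 / 2) * t ^ 2 := by ring
  unfold coordDensity
  rw [hexp]
  rcases ha.eq_or_lt with rfl | ha
  · simp
  · have ht : 0 < t := ht ha
    rw [abs_of_pos ht, Real.rpow_add ht, Real.rpow_two]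
    exact ⟨rfl, by ring⟩

theorem integrableOn_mul_coordDensity (ha : 0 ≤ a) {φ : ℝ → ℝ} (hφ : Measurable φ) {K : ℝ}
    (hK : ∀ t, |φ t| ≤ K * (1 + |t|) ^ 2) :
    IntegrableOn (fun t => φ t * coordDensity a t) (coordSet a) := by
  have h1 := integrable_rpow_mul_exp_neg_mul_sq (b := 1 / 2) (by norm_num) (s := a) (by linarith)
  have h2 := integrable_rpow_mul_exp_neg_mul_sq (b := 1 / 2) (by norm_num) (s := a + 2)
    (by linarith)
  refine ((h1.add h2).const_mul (2 * K)).integrableOn.mono'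
    (hφ.mul (continuous_coordDensity ha).measurable).aestronglyMeasurable ?_
  refine (ae_restrict_iff' (measurableSet_coordSet a)).2 (ae_of_all _ fun t ht => ?_)
  obtain ⟨e1, e2⟩ := coordDensity_eq_rpow ha ht
  have h0 := coordDensity_nonneg a t
  simp only [Pi.add_apply]
  rw [← e1, ← e2, Real.norm_eq_abs, abs_mul, abs_of_nonneg h0]
  have hK0 : 0 ≤ K := by simpa using (abs_nonneg _).trans (hK 0)
  have h3 : (1 + |t|) ^ 2 ≤ 2 * (1 + t ^ 2) := by nlinarith [sq_nonneg (1 - |t|), sq_abs t]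
  calc |φ t| * coordDensity a t ≤ K * (2 * (1 + t ^ 2)) * coordDensity a t := by
        gcongr
        exact (hK t).trans (by gcongr)
    _ = _ := by ring

theorem measurable_ofReal_coordDensity (ha : 0 ≤ a) :
    Measurable fun t => ENNReal.ofReal (coordDensity a t) :=
  (continuous_coordDensity ha).measurable.ennreal_ofReal

theorem integrableOn_coordDensity (ha : 0 ≤ a) : IntegrableOn (coordDensity a) (coordSet a) := by
  simpa using integrableOn_mul_coordDensity ha (φ := fun _ => 1) measurable_const (K := 1)
    fun t => by
      rw [abs_one, one_mul]
      exact one_le_pow₀ (by linarith [abs_nonneg t])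

theorem isFiniteMeasure_coordMass (ha : 0 ≤ a) : IsFiniteMeasure (coordMass a) :=
  isFiniteMeasure_withDensity_ofReal (integrableOn_coordDensity ha).2

theorem coordMass_univ_ne_zero (ha : 0 ≤ a) : coordMass a univ ≠ 0 := by
  rw [coordMass, withDensity_apply _ MeasurableSet.univ, Measure.restrict_univ]
  refine ((setLIntegral_pos_iff (measurable_ofReal_coordDensity ha)).2 ?_).ne'
  refine lt_of_lt_of_le ?_ (measure_mono (s := Ioi (0 : ℝ)) fun t (ht : 0 < t) => ⟨?_, fun _ => ht⟩)
  · simp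
  · have : 0 < coordDensity a t := by
      unfold coordDensity
      positivity
    simpa using this

theorem isProbabilityMeasure_coordGauss (ha : 0 ≤ a) : IsProbabilityMeasure (coordGauss a) := by
  have := isFiniteMeasure_coordMass ha
  refine ⟨?_⟩
  rw [coordGauss, Measure.smul_apply, smul_eq_mul]
  exact ENNReal.inv_mul_cancel (coordMass_univ_ne_zero ha) (measure_ne_top _ _)

theorem integral_coordGauss (ha : 0 ≤ a) (φ : ℝ → ℝ) :
    ∫ t, φ t ∂coordGauss a =
      ((coordMass a univ)⁻¹).toReal * ∫ t in coordSet a, φ t * coordDensity a t := by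
  rw [coordGauss, integral_smul_measure, coordMass, integral_withDensity_eq_integral_toReal_smul
    (measurable_ofReal_coordDensity ha) (ae_of_all _ fun _ => ENNReal.ofReal_lt_top), smul_eq_mul]
  simp only [ENNReal.toReal_ofReal (coordDensity_nonneg a _), smul_eq_mul, mul_comm]

theorem integrable_coordGauss (ha : 0 ≤ a) {φ : ℝ → ℝ} (hφ : Measurable φ) {K : ℝ}
    (hK : ∀ t, |φ t| ≤ K * (1 + |t|) ^ 2) : Integrable φ (coordGauss a) := by
  refine Integrable.smul_measure ?_ (ENNReal.inv_ne_top.2 (coordMass_univ_ne_zero ha))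
  rw [coordMass, integrable_withDensity_iff (measurable_ofReal_coordDensity ha)
    (ae_of_all _ fun _ => ENNReal.ofReal_lt_top)]
  simpa only [ENNReal.toReal_ofReal (coordDensity_nonneg a _)] using!
    integrableOn_mul_coordDensity ha hφ hK

theorem hasDerivAt_coordDensity {t : ℝ} (ht : 0 < t) :
    HasDerivAt (coordDensity a) ((a / t - t) * coordDensity a t) t := by
  have h1 : HasDerivAt (fun t : ℝ => t ^ a * Real.exp (-t ^ 2 / 2))
      (a * t ^ (a - 1) * Real.exp (-t ^ 2 / 2) + t ^ a * (Real.exp (-t ^ 2 / 2) * -t)) t := by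
    refine (Real.hasDerivAt_rpow_const (Or.inl ht.ne')).mul (HasDerivAt.exp ?_)
    exact ((hasDerivAt_pow 2 t).neg.div_const 2).congr_deriv (by push_cast; ring)
  refine (h1.congr_of_eventuallyEq ?_).congr_deriv ?_
  · filter_upwards [lt_mem_nhds ht] with s hs
    rw [coordDensity, abs_of_pos hs]
  · rw [coordDensity, abs_of_pos ht, Real.rpow_sub_one ht.ne']
    ring

theorem hasDerivAt_coordDensity_zero (t : ℝ) :
    HasDerivAt (coordDensity 0) (-t * coordDensity 0 t) t := by
  have h0 : coordDensity 0 = fun t => Real.exp (-t ^ 2 / 2) := by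
    ext t
    simp [coordDensity]
  rw [h0]
  have h1 : HasDerivAt (fun t : ℝ => -t ^ 2 / 2) (-t) t := by
    exact ((hasDerivAt_pow 2 t).neg.div_const 2).congr_deriv (by push_cast; ring)
  exact h1.exp.congr_deriv (by ring)

/-- The functions of linear growth together with their derivatives. -/
structure HasLinearGrowthDeriv (f f' : ℝ → ℝ) : Prop where
  hasDerivAt : ∀ t, HasDerivAt f (f' t) t
  bound : ∃ K : ℝ, ∀ t, |f t| ≤ K * (1 + |t|) ∧ |f' t| ≤ K * (1 + |t|)

namespace HasLinearGrowthDeriv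

variable {f f' : ℝ → ℝ}

theorem measurable (h : HasLinearGrowthDeriv f f') : Measurable f :=
  (continuous_iff_continuousAt.2 fun t => (h.hasDerivAt t).continuousAt).measurable

theorem measurable_deriv (h : HasLinearGrowthDeriv f f') : Measurable f' := by
  rw [← funext fun t => (h.hasDerivAt t).deriv]
  exact _root_.measurable_deriv f

theorem affine (b c : ℝ) : HasLinearGrowthDeriv (fun t => b + c * t) fun _ => c where
  hasDerivAt t := (((hasDerivAt_id t).const_mul c).const_add b).congr_deriv (mul_one c)
  bound := by
    refine ⟨|b| + |c|, fun t => ⟨(abs_add_le _ _).trans ?_, ?_⟩⟩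
    · rw [abs_mul]
      nlinarith [abs_nonneg b, abs_nonneg c, abs_nonneg t,
        mul_nonneg (abs_nonneg b) (abs_nonneg t)]
    · nlinarith [abs_nonneg b, abs_nonneg c, abs_nonneg t,
        mul_nonneg (abs_nonneg b) (abs_nonneg t), mul_nonneg (abs_nonneg c) (abs_nonneg t)]

theorem sub {g g' : ℝ → ℝ} (h : HasLinearGrowthDeriv f f') (hg : HasLinearGrowthDeriv g g') :
    HasLinearGrowthDeriv (fun t => f t - g t) fun t => f' t - g' t where
  hasDerivAt t := (h.hasDerivAt t).sub (hg.hasDerivAt t)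
  bound := by
    obtain ⟨K, hK⟩ := h.bound
    obtain ⟨L, hL⟩ := hg.bound
    refine ⟨K + L, fun t => ⟨(abs_sub _ _).trans ?_, (abs_sub _ _).trans ?_⟩⟩
    · linarith [(hK t).1, (hL t).1]
    · linarith [(hK t).2, (hL t).2]

end HasLinearGrowthDeriv

theorem abs_mul_le_of_linear {x y K L t : ℝ} (hx : |x| ≤ K * (1 + |t|))
    (hy : |y| ≤ L * (1 + |t|)) : |x * y| ≤ K * L * (1 + |t|) ^ 2 := by
  rw [abs_mul]
  exact (mul_le_mul hx hy (abs_nonneg _) ((abs_nonneg _).trans hx)).trans_eq (by ring)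

namespace HasLinearGrowthDeriv

variable {f f' g g' : ℝ → ℝ}

theorem integrable_mul (h : HasLinearGrowthDeriv f f') (hg : HasLinearGrowthDeriv g g')
    (ha : 0 ≤ a) : Integrable (fun t => f t * g t) (coordGauss a) := by
  obtain ⟨K, hK⟩ := h.bound
  obtain ⟨L, hL⟩ := hg.bound
  exact integrable_coordGauss ha (h.measurable.mul hg.measurable)
    fun t => abs_mul_le_of_linear (hK t).1 (hL t).1

theorem integrable_mul_deriv (h : HasLinearGrowthDeriv f f') (hg : HasLinearGrowthDeriv g g')
    (ha : 0 ≤ a) : Integrable (fun t => f t * g' t) (coordGauss a) := by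
  obtain ⟨K, hK⟩ := h.bound
  obtain ⟨L, hL⟩ := hg.bound
  exact integrable_coordGauss ha (h.measurable.mul hg.measurable_deriv)
    fun t => abs_mul_le_of_linear (hK t).1 (hL t).2

theorem integrable_deriv_mul_deriv (h : HasLinearGrowthDeriv f f')
    (hg : HasLinearGrowthDeriv g g') (ha : 0 ≤ a) :
    Integrable (fun t => f' t * g' t) (coordGauss a) := by
  obtain ⟨K, hK⟩ := h.bound
  obtain ⟨L, hL⟩ := hg.bound
  exact integrable_coordGauss ha (h.measurable_deriv.mul hg.measurable_deriv)
    fun t => abs_mul_le_of_linear (hK t).2 (hL t).2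

theorem integrable (h : HasLinearGrowthDeriv f f') (ha : 0 ≤ a) :
    Integrable f (coordGauss a) := by
  simpa using h.integrable_mul (affine 1 0) ha

theorem integrable_deriv (h : HasLinearGrowthDeriv f f') (ha : 0 ≤ a) :
    Integrable f' (coordGauss a) := by
  simpa using (affine 1 0).integrable_mul_deriv h ha

theorem integrable_sq (h : HasLinearGrowthDeriv f f') (ha : 0 ≤ a) :
    Integrable (fun t => f t ^ 2) (coordGauss a) := by
  simpa only [sq] using h.integrable_mul h ha

theorem integrable_deriv_sq (h : HasLinearGrowthDeriv f f') (ha : 0 ≤ a) :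
    Integrable (fun t => f' t ^ 2) (coordGauss a) := by
  simpa only [sq] using h.integrable_deriv_mul_deriv h ha

theorem two_mul_integral_sq_le_of_setIntegral (h : HasLinearGrowthDeriv f f') (ha : 0 ≤ a)
    (hpos : 0 ≤ ∫ t in coordSet a, (f' t ^ 2 - 2 * f t ^ 2) * coordDensity a t) :
    2 * ∫ t, f t ^ 2 ∂coordGauss a ≤ ∫ t, f' t ^ 2 ∂coordGauss a := by
  have h1 := mul_nonneg (ENNReal.toReal_nonneg (a := (coordMass a univ)⁻¹)) hpos
  rw [← integral_coordGauss ha (fun t => f' t ^ 2 - 2 * f t ^ 2), integral_sub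
    (h.integrable_deriv_sq ha) ((h.integrable_sq ha).const_mul 2), integral_const_mul] at h1
  linarith

theorem integrableOn_density (h : HasLinearGrowthDeriv f f') (ha : 0 ≤ a) :
    IntegrableOn (fun t => (f' t ^ 2 - 2 * f t ^ 2) * coordDensity a t) (coordSet a) := by
  obtain ⟨K, hK⟩ := h.bound
  refine integrableOn_mul_coordDensity ha ((h.measurable_deriv.pow_const 2).sub
    ((h.measurable.pow_const 2).const_mul 2)) (K := 3 * K ^ 2) fun t => ?_
  have h1 := abs_mul_le_of_linear (hK t).1 (hK t).1
  have h2 := abs_mul_le_of_linear (hK t).2 (hK t).2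
  rw [abs_mul_self] at h1 h2
  rw [abs_le]
  constructor <;> nlinarith [mul_self_nonneg (f t), mul_self_nonneg (f' t)]

theorem two_mul_variance_le (h : HasLinearGrowthDeriv f f') (ha : 0 < a) :
    2 * (∫ t, f t ^ 2 ∂coordGauss a - (∫ t, f t ∂coordGauss a) ^ 2) ≤
      ∫ t, f' t ^ 2 ∂coordGauss a := by
  have := isProbabilityMeasure_coordGauss ha.le
  set c := f (√(1 + a)) with hc
  have hg : HasLinearGrowthDeriv (fun t => f t - c) f' := by
    simpa using h.sub (affine c 0)
  have hInt := hg.integrableOn_density ha.le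
  have key := hg.two_mul_integral_sq_le_of_setIntegral ha.le (by
    rw [coordSet_of_pos ha] at hInt ⊢
    refine two_mul_setIntegral_Ioi_sq_le (s := 1 + a) (by positivity)
      (continuous_coordDensity ha.le) (fun t _ => coordDensity_nonneg a t)
      (fun t ht => hasDerivAt_coordDensity ht) (fun t ht => ?_) hg.hasDerivAt (by simp [hc]) hInt
    field_simp
    ring)
  have hexp : ∫ t, (f t - c) ^ 2 ∂coordGauss a =
      (∫ t, f t ^ 2 ∂coordGauss a) + (-2 * c) * (∫ t, f t ∂coordGauss a) + c ^ 2 := by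
    have hpt : ∀ t, (f t - c) ^ 2 = f t ^ 2 + (-2 * c) * f t + c ^ 2 := fun t => by ring
    have i1 := (h.integrable_sq ha.le).add ((h.integrable ha.le).const_mul (-2 * c))
    simp_rw [hpt]
    rw [integral_add (by exact i1) (integrable_const _), integral_add (h.integrable_sq ha.le)
      ((h.integrable ha.le).const_mul _), integral_const_mul]
    simp
  rw [hexp] at key
  nlinarith [sq_nonneg (c - ∫ t, f t ∂coordGauss a)]

theorem integral_mul_eq_integral_deriv (h : HasLinearGrowthDeriv f f') :
    ∫ t, f t * t ∂coordGauss 0 = ∫ t, f' t ∂coordGauss 0 := by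
  have hid := affine 0 1
  simp only [zero_add, one_mul] at hid
  have hsub := integral_sub (h.integrable_deriv le_rfl) (h.integrable_mul hid le_rfl)
  have hzero : ∫ t, (f' t - f t * t) * coordDensity 0 t = 0 := by
    obtain ⟨K, hK⟩ := h.bound
    have hK0 : 0 ≤ K := by simpa using (abs_nonneg _).trans (hK 0).1
    have hl : ∀ t : ℝ, K * (1 + |t|) ≤ K * (1 + |t|) ^ 2 := fun t => by
      nlinarith [abs_nonneg t, mul_nonneg hK0 (abs_nonneg t)]
    have i1 : Integrable fun t => (f' t - f t * t) * coordDensity 0 t := by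
      rw [← integrableOn_univ, ← coordSet_zero]
      refine integrableOn_mul_coordDensity le_rfl
        (h.measurable_deriv.sub (h.measurable.mul measurable_id)) (K := K + K) fun t => ?_
      have h1 := abs_mul_le_of_linear (x := f t) (y := t) (hK t).1 (L := 1) (by
        rw [one_mul]
        linarith)
      have h2 := abs_sub (f' t) (f t * t)
      linarith [(hK t).2, hl t]
    have i2 : Integrable fun t => f t * coordDensity 0 t := by
      rw [← integrableOn_univ, ← coordSet_zero]
      exact integrableOn_mul_coordDensity le_rfl h.measurable (K := K)
        fun t => (hK t).1.trans (hl t)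
    refine integral_eq_zero_of_hasDerivAt_of_integrable (fun t => ?_) i1 i2
    refine ((h.hasDerivAt t).mul (hasDerivAt_coordDensity_zero t)).congr_deriv ?_
    ring
  rw [integral_coordGauss le_rfl, coordSet_zero, Measure.restrict_univ, hzero, mul_zero] at hsub
  linarith

end HasLinearGrowthDeriv

theorem integral_id_coordGauss_zero : ∫ t, t ∂coordGauss 0 = 0 := by
  simpa using (HasLinearGrowthDeriv.affine 1 0).integral_mul_eq_integral_deriv

theorem integral_sq_coordGauss_zero : ∫ t, t ^ 2 ∂coordGauss 0 = 1 := by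
  have := isProbabilityMeasure_coordGauss (a := 0) le_rfl
  simpa [sq] using (HasLinearGrowthDeriv.affine 0 1).integral_mul_eq_integral_deriv

theorem HasLinearGrowthDeriv.two_mul_variance_sub_le {f f' : ℝ → ℝ}
    (h : HasLinearGrowthDeriv f f') :
    2 * (∫ t, f t ^ 2 ∂coordGauss 0 - (∫ t, f t ∂coordGauss 0) ^ 2)
      - (∫ t, f t * t ∂coordGauss 0) ^ 2 ≤ ∫ t, f' t ^ 2 ∂coordGauss 0 := by
  have := isProbabilityMeasure_coordGauss (a := 0) le_rfl
  set b := (f 1 - f (-1)) / 2 with hb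
  set d := (f 1 + f (-1)) / 2 with hd
  have hg := h.sub (affine d b)
  have hid := affine 0 1
  simp only [zero_add, one_mul] at hid
  have hInt := hg.integrableOn_density (a := 0) le_rfl
  have key := hg.two_mul_integral_sq_le_of_setIntegral (a := 0) le_rfl (by
    rw [coordSet_zero] at hInt ⊢
    rw [Measure.restrict_univ]
    exact two_mul_integral_sq_le (coordDensity_nonneg 0) hasDerivAt_coordDensity_zero
      (fun t => rfl) hg.hasDerivAt (by rw [hb, hd]; ring) (by rw [hb, hd]; ring)
      (integrableOn_univ.1 hInt))
  have hsq : ∫ t, (f t - (d + b * t)) ^ 2 ∂coordGauss 0 =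
      (∫ t, f t ^ 2 ∂coordGauss 0) + (-2 * d) * (∫ t, f t ∂coordGauss 0)
        + (-2 * b) * (∫ t, f t * t ∂coordGauss 0) + d ^ 2 + b ^ 2 := by
    have hpt : ∀ t, (f t - (d + b * t)) ^ 2 = f t ^ 2 + (-2 * d) * f t + (-2 * b) * (f t * t)
        + d ^ 2 + (2 * d * b) * t + b ^ 2 * t ^ 2 := fun t => by ring
    have i1 := h.integrable_sq (a := 0) le_rfl
    have i2 := i1.add ((h.integrable le_rfl).const_mul (-2 * d))
    have i3 := i2.add ((h.integrable_mul hid le_rfl).const_mul (-2 * b))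
    have i4 := i3.add (integrable_const (d ^ 2))
    have i5 := i4.add ((hid.integrable le_rfl).const_mul (2 * d * b))
    have hmean : ∫ t, (2 * d * b) * t ∂coordGauss 0 = 0 := by
      rw [integral_const_mul, integral_id_coordGauss_zero, mul_zero]
    simp_rw [hpt]
    rw [integral_add (by exact i5) ((hid.integrable_sq le_rfl).const_mul _),
      integral_add (by exact i4) ((hid.integrable le_rfl).const_mul _),
      integral_add (by exact i3) (integrable_const _),
      integral_add (by exact i2) ((h.integrable_mul hid le_rfl).const_mul _),
      integral_add i1 ((h.integrable le_rfl).const_mul _), hmean]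
    simp only [integral_const_mul, integral_sq_coordGauss_zero,
      integral_const, probReal_univ, one_smul]
    ring
  have hsq' : ∫ t, (f' t - b) ^ 2 ∂coordGauss 0 =
      (∫ t, f' t ^ 2 ∂coordGauss 0) + (-2 * b) * (∫ t, f t * t ∂coordGauss 0) + b ^ 2 := by
    have hpt : ∀ t, (f' t - b) ^ 2 = f' t ^ 2 + (-2 * b) * f' t + b ^ 2 := fun t => by ring
    have i1 := h.integrable_deriv_sq (a := 0) le_rfl
    have i2 := i1.add ((h.integrable_deriv le_rfl).const_mul (-2 * b))
    simp_rw [hpt]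
    rw [integral_add (by exact i2) (integrable_const _),
      integral_add i1 ((h.integrable_deriv le_rfl).const_mul _), integral_const_mul,
      h.integral_mul_eq_integral_deriv]
    simp
  rw [hsq, hsq'] at key
  nlinarith [sq_nonneg (d - ∫ t, f t ∂coordGauss 0), sq_nonneg (b - ∫ t, f t * t ∂coordGauss 0)]

end OneDimensional

section MonomialGaussian

theorem MeasureTheory.MeasurePreserving.map_restrict_withDensity {X Y : Type*}
    [MeasurableSpace X] [MeasurableSpace Y] {μ : Measure X} {ν : Measure Y} {p : X → Y}
    (hp : MeasurePreserving p μ ν) {s : Set Y} (hs : MeasurableSet s) {G : Y → ENNReal}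
    (hG : Measurable G) :
    ((μ.restrict (p ⁻¹' s)).withDensity fun x => G (p x)).map p =
      (ν.restrict s).withDensity G := by
  ext t ht
  rw [Measure.map_apply hp.measurable ht, withDensity_apply _ (hp.measurable ht),
    withDensity_apply _ ht, Measure.restrict_restrict (hp.measurable ht),
    Measure.restrict_restrict ht, ← preimage_inter, hp.setLIntegral_comp_preimage (ht.inter hs) hG]

theorem pi_withDensity_ofReal {ι : Type*} [Fintype ι] {μ : ι → Measure ℝ} [∀ i, SigmaFinite (μ i)]
    {ρ : ι → ℝ → ℝ} (h0 : ∀ i t, 0 ≤ ρ i t) (hInt : ∀ i, Integrable (ρ i) (μ i)) :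
    Measure.pi (fun i => (μ i).withDensity fun t => ENNReal.ofReal (ρ i t)) =
      (Measure.pi μ).withDensity fun x => ENNReal.ofReal (∏ i, ρ i (x i)) := by
  have := fun i => isFiniteMeasure_withDensity_ofReal (hInt i).2
  refine Measure.pi_eq fun s hs => ?_
  rw [withDensity_apply _ (MeasurableSet.univ_pi hs), Measure.restrict_pi_pi,
    ← ofReal_integral_eq_lintegral_ofReal (Integrable.fintype_prod fun i => (hInt i).integrableOn)
      (ae_of_all _ fun x => Finset.prod_nonneg fun i _ => h0 i _),
    integral_fintype_prod_eq_prod,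
    ENNReal.ofReal_prod_of_nonneg fun i _ => integral_nonneg (h0 i)]
  refine Finset.prod_congr rfl fun i _ => ?_
  rw [withDensity_apply _ (hs i), ofReal_integral_eq_lintegral_ofReal (hInt i).integrableOn
    (ae_of_all _ (h0 i))]

variable {N : ℕ} {α : Fin N → ℝ}

theorem monWeight_mul_exp (x : EuclideanSpace ℝ (Fin N)) (hx : x ∈ chamber α)
    (hα : ∀ i, 0 ≤ α i) :
    monWeight α x * Real.exp (-‖x‖ ^ 2 / 2) = ∏ i, coordDensity (α i) (x i) := by
  have hexp : -‖x‖ ^ 2 / 2 = ∑ i, -x i ^ 2 / 2 := by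
    rw [EuclideanSpace.real_norm_sq_eq, ← Finset.sum_neg_distrib, Finset.sum_div]
  rw [monWeight, hexp, Real.exp_sum, ← Finset.prod_mul_distrib]
  refine Finset.prod_congr rfl fun i _ => ?_
  rw [coordDensity]
  rcases (hα i).eq_or_lt with h | h
  · simp [← h]
  · rw [abs_of_pos (hx i h)]

theorem map_ofLp_monGauss (hα : ∀ i, 0 ≤ α i) :
    ((volume.restrict (chamber α)).withDensity
      fun x => ENNReal.ofReal (monWeight α x * Real.exp (-‖x‖ ^ 2 / 2))).map WithLp.ofLp =
        Measure.pi fun i => coordMass (α i) := by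
  have hch : chamber α = WithLp.ofLp ⁻¹' univ.pi fun i => coordSet (α i) := by
    ext x
    simp [chamber, coordSet]
  have hms : MeasurableSet (univ.pi fun i => coordSet (α i)) :=
    MeasurableSet.univ_pi fun i => measurableSet_coordSet _
  have hp := PiLp.volume_preserving_ofLp (Fin N)
  have hG : Measurable fun x : Fin N → ℝ => ENNReal.ofReal (∏ i, coordDensity (α i) (x i)) :=
    (Finset.measurable_prod _ fun i _ => (continuous_coordDensity (hα i)).measurable.comp
      (measurable_pi_apply i)).ennreal_ofReal
  unfold coordMass
  rw [pi_withDensity_ofReal (fun i => coordDensity_nonneg _)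
    fun i => integrableOn_coordDensity (hα i), ← Measure.restrict_pi_pi, ← volume_pi,
    ← hp.map_restrict_withDensity hms hG, ← hch]
  congr 1
  refine withDensity_congr_ae ((ae_restrict_iff' (hch ▸ hp.measurable hms)).2
    (ae_of_all _ fun x hx => ?_))
  simp only [monWeight_mul_exp x hx hα]

theorem measurePreserving_ofLp_monGauss (hα : ∀ i, 0 ≤ α i) :
    MeasurePreserving WithLp.ofLp (monGauss α) (Measure.pi fun i => coordGauss (α i)) := by
  have := fun i => isFiniteMeasure_coordMass (hα i)
  have := fun i => isProbabilityMeasure_coordGauss (hα i)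
  have hp := (PiLp.volume_preserving_ofLp (Fin N)).measurable
  refine ⟨hp, (Measure.pi_eq fun s hs => ?_).symm⟩
  rw [monGauss, Measure.map_smul, map_ofLp_monGauss hα, Measure.smul_apply, Measure.pi_pi,
    ← preimage_univ (f := @WithLp.ofLp 2 (Fin N → ℝ)), ← Measure.map_apply hp MeasurableSet.univ,
    map_ofLp_monGauss hα, Measure.pi_univ, smul_eq_mul,
    ENNReal.prod_inv_distrib fun i _ j _ _ => Or.inl (coordMass_univ_ne_zero (hα i)),
    ← Finset.prod_mul_distrib]
  exact Finset.prod_congr rfl fun i _ => rfl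

theorem integral_monGauss (hα : ∀ i, 0 ≤ α i) (f : EuclideanSpace ℝ (Fin N) → ℝ) :
    ∫ x, f x ∂monGauss α =
      ∫ x, f (WithLp.toLp 2 x) ∂Measure.pi fun i => coordGauss (α i) :=
  (measurePreserving_ofLp_monGauss hα).integral_comp
    (MeasurableEquiv.toLp 2 (Fin N → ℝ)).symm.measurableEmbedding fun x => f (WithLp.toLp 2 x)

theorem isCoordSystem_coordGauss (hα : ∀ i, 0 ≤ α i) :
    IsCoordSystem (fun i => coordGauss (α i)) fun i => coordFun (α i) where
  prob i := isProbabilityMeasure_coordGauss (hα i)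
  moment i := integrable_coordGauss (hα i) (by fun_prop) (K := 1) fun t => by
    rw [one_mul, abs_of_nonneg (by positivity)]
  meas i := by
    unfold coordFun
    split_ifs <;> fun_prop
  bound i t := by
    unfold coordFun
    split_ifs
    · linarith
    · rw [abs_zero]
      positivity
  centered i := by
    by_cases h : α i = 0
    · simp only [coordFun, h, if_true, integral_id_coordGauss_zero]
    · simp [coordFun, h]
  normalized i t := by
    by_cases h : α i = 0
    · simp only [coordFun, h, if_true, integral_sq_coordGauss_zero, one_mul]
    · simp [coordFun, h]

theorem bounded_mem_growthSpace {ι : Type*} [Fintype ι] {f : (ι → ℝ) → ℝ} (hf : Measurable f)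
    {K : ℝ} (hK : ∀ x, |f x| ≤ K) : f ∈ growthSpace ι := by
  have hK0 := (abs_nonneg _).trans (hK 0)
  exact ⟨hf, K, hK0, fun x => (hK x).trans
    (le_mul_of_one_le_right hK0 (IsCoordSystem.one_le_prod_one_add_abs _ x))⟩

theorem norm_gradient_sq_eq_sum (u : EuclideanSpace ℝ (Fin N) → ℝ)
    (x : EuclideanSpace ℝ (Fin N)) :
    ‖gradient u x‖ ^ 2 = ∑ i, fderiv ℝ u x (EuclideanSpace.single i 1) ^ 2 := by
  rw [EuclideanSpace.real_norm_sq_eq]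
  refine Finset.sum_congr rfl fun i _ => ?_
  rw [← inner_gradient_left, EuclideanSpace.inner_single_right]
  simp

theorem hasDerivAt_slice {u : EuclideanSpace ℝ (Fin N) → ℝ} (hu : Differentiable ℝ u) (i : Fin N)
    (x : Fin N → ℝ) (t : ℝ) :
    HasDerivAt (fun t => u (WithLp.toLp 2 (Function.update x i t)))
      (fderiv ℝ u (WithLp.toLp 2 (Function.update x i t)) (EuclideanSpace.single i 1)) t :=
  (hu _).hasFDerivAt.comp_hasDerivAt t
    ((PiLp.hasFDerivAt_toLp 2 (Function.update x i t)).comp_hasDerivAt t (hasDerivAt_update x i t))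

end MonomialGaussian

namespace IsCoordSystem

variable {ι : Type*} [Fintype ι] [DecidableEq ι] {ν : ι → Measure ℝ} {e : ι → ℝ → ℝ}

omit [Fintype ι] [DecidableEq ι] in
theorem integrable_id (h : IsCoordSystem ν e) (i : ι) : Integrable (fun t => t) (ν i) :=
  h.integrable_of_bound i measurable_id (K := 1) fun t => by nlinarith [abs_nonneg t]

/-- The centered coordinate function. -/
noncomputable def centeredCoord (w : ι → ℝ) (i : ι) : growthSpace ι :=
  ⟨fun x => x i, coord_mem_growthSpace measurable_id fun t => by
    rw [id]
    linarith [abs_nonneg t]⟩ - ⟨fun _ => w i, bounded_mem_growthSpace measurable_const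
    fun _ => le_rfl⟩

theorem integral_centered_mul_centered (h : IsCoordSystem ν e) {j k : ι} (hjk : k ≠ j)
    {w : ι → ℝ} (hw : ∀ i, ∫ t, t ∂ν i = w i) :
    ∫ x, (x j - w j) * (x k - w k) ∂Measure.pi ν = 0 := by
  have := h.prob
  have havg : ∀ x, (h.average j (centeredCoord w j)).1 x = 0 := fun x => by
    rw [average_apply]
    change ∫ t, (Function.update x j t j - w j) ∂ν j = 0
    simp only [Function.update_self]
    rw [integral_sub (h.integrable_id j) (integrable_const _), hw]
    simp
  refine (h.integral_average_mul j (centeredCoord w j) (centeredCoord w k) fun x t => ?_).symm.trans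
    (by simp [havg])
  change Function.update x j t k - w k = x k - w k
  rw [Function.update_of_ne hjk]

/-- Subtracting from a function its projection on the affine functions of the coordinates. -/
theorem integral_sub_affine_sq (h : IsCoordSystem ν e) (f : growthSpace ι) {w V : ι → ℝ}
    (hw : ∀ i, ∫ t, t ∂ν i = w i) (hV : ∀ i, ∫ t, (t - w i) ^ 2 ∂ν i = V i) {m : ℝ}
    (hm : ∫ x, f.1 x ∂Measure.pi ν = m) {c : ι → ℝ}
    (hc : ∀ i, ∫ x, f.1 x * x i ∂Measure.pi ν - m * w i = c i) :
    ∫ x, (f.1 x - m - ∑ i, c i * (x i - w i)) ^ 2 ∂Measure.pi ν =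
      ∫ x, (f.1 x - m) ^ 2 ∂Measure.pi ν - 2 * ∑ i, c i ^ 2 + ∑ i, c i ^ 2 * V i := by
  have := h.prob
  let H : growthSpace ι := f - ⟨fun _ => m, bounded_mem_growthSpace measurable_const
    fun _ => le_rfl⟩
  have iH : ∀ i, Integrable (fun x => (f.1 x - m) * (x i - w i)) (Measure.pi ν) := fun i =>
    h.integrable_mul H (centeredCoord w i)
  have iX : ∀ i j, Integrable (fun x : ι → ℝ => (x i - w i) * (x j - w j)) (Measure.pi ν) :=
    fun i j => h.integrable_mul (centeredCoord w i) (centeredCoord w j)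
  have hH : ∀ i, ∫ x, (f.1 x - m) * (x i - w i) ∂Measure.pi ν = c i := fun i => by
    have hpt : ∀ x : ι → ℝ, (f.1 x - m) * (x i - w i) =
        (f.1 x * x i - w i * f.1 x) - m * (x i - w i) := fun x => by ring
    have i0 : Integrable (fun x : ι → ℝ => x i - w i) (Measure.pi ν) :=
      h.integrable (centeredCoord w i)
    have i1 : Integrable (fun x => f.1 x * x i) (Measure.pi ν) := by
      refine ((h.integrable_mul f (centeredCoord w i)).add ((h.integrable f).const_mul (w i))).congr
        (ae_of_all _ fun x => ?_)
      change f.1 x * (x i - w i) + w i * f.1 x = f.1 x * x i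
      ring
    have h0 : ∫ x, (x i - w i) ∂Measure.pi ν = 0 := by
      rw [integral_comp_eval (μ := ν) (i := i) (f := fun t : ℝ => t - w i) (by fun_prop),
        integral_sub (h.integrable_id i) (integrable_const _), hw]
      simp
    simp_rw [hpt]
    rw [integral_sub (by exact i1.sub ((h.integrable f).const_mul _)) (i0.const_mul _),
      integral_sub i1 ((h.integrable f).const_mul _), integral_const_mul, integral_const_mul, h0,
      hm, ← hc i]
    ring
  have hX : ∀ i, ∑ j, c i * c j * ∫ x, (x i - w i) * (x j - w j) ∂Measure.pi ν =
      c i ^ 2 * V i := fun i => by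
    rw [Finset.sum_eq_single i (fun j _ hji => by
      rw [h.integral_centered_mul_centered hji hw, mul_zero]) (by simp), ← hV i]
    simp_rw [← sq]
    rw [integral_comp_eval (μ := ν) (i := i) (f := fun t : ℝ => (t - w i) ^ 2) (by fun_prop)]
  have hpt : ∀ x : ι → ℝ, (f.1 x - m - ∑ i, c i * (x i - w i)) ^ 2 =
      (f.1 x - m) ^ 2 - 2 * ∑ i, c i * ((f.1 x - m) * (x i - w i))
        + ∑ i, ∑ j, c i * c j * ((x i - w i) * (x j - w j)) := fun x => by
    have h1 : ∑ i, c i * ((f.1 x - m) * (x i - w i)) =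
        (f.1 x - m) * ∑ i, c i * (x i - w i) := by
      rw [Finset.mul_sum]
      exact Finset.sum_congr rfl fun i _ => by ring
    have h2 : ∑ i, ∑ j, c i * c j * ((x i - w i) * (x j - w j)) =
        (∑ i, c i * (x i - w i)) * ∑ i, c i * (x i - w i) := by
      rw [Finset.sum_mul_sum]
      exact Finset.sum_congr rfl fun i _ => Finset.sum_congr rfl fun j _ => by ring
    rw [h1, h2]
    ring
  have j1 : Integrable (fun x => (f.1 x - m) ^ 2) (Measure.pi ν) := h.integrable_sq H
  have j2 : Integrable (fun x => 2 * ∑ i, c i * ((f.1 x - m) * (x i - w i))) (Measure.pi ν) :=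
    (integrable_finsetSum _ fun i _ => (iH i).const_mul (c i)).const_mul 2
  have j3 : ∀ i, Integrable (fun x => ∑ j, c i * c j * ((x i - w i) * (x j - w j)))
      (Measure.pi ν) := fun i => integrable_finsetSum _ fun j _ => (iX i j).const_mul _
  simp_rw [hpt]
  rw [integral_add (by exact j1.sub j2) (integrable_finsetSum _ fun i _ => j3 i),
    integral_sub j1 j2, integral_const_mul, integral_finsetSum _ fun i _ => (iH i).const_mul (c i),
    integral_finsetSum _ fun i _ => j3 i]
  simp_rw [integral_finsetSum _ fun j _ => (iX _ j).const_mul _, integral_const_mul, hH, hX, ← sq]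

end IsCoordSystem

section MonomialGaussian

theorem variance_coordGauss {a : ℝ} (ha : 0 ≤ a) {w : ℝ} (hw : ∫ t, t ∂coordGauss a = w) :
    ∫ t, (t - w) ^ 2 ∂coordGauss a = ∫ t, t ^ 2 ∂coordGauss a - w ^ 2 := by
  have := isProbabilityMeasure_coordGauss ha
  have hid := HasLinearGrowthDeriv.affine 0 1
  simp only [zero_add, one_mul] at hid
  have hpt : ∀ t : ℝ, (t - w) ^ 2 = t ^ 2 - (2 * w) * t + w ^ 2 := fun t => by ring
  have i1 := (hid.integrable_sq ha).sub ((hid.integrable ha).const_mul (2 * w))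
  simp_rw [hpt]
  rw [integral_add (by exact i1) (integrable_const _), integral_sub (hid.integrable_sq ha)
    ((hid.integrable ha).const_mul _), integral_const_mul, hw]
  simp
  ring

theorem two_mul_variance_coordGauss_le {a : ℝ} (ha : 0 < a) {w : ℝ}
    (hw : ∫ t, t ∂coordGauss a = w) : 2 * ∫ t, (t - w) ^ 2 ∂coordGauss a ≤ 1 := by
  have := isProbabilityMeasure_coordGauss ha.le
  have h := (HasLinearGrowthDeriv.affine 0 1).two_mul_variance_le ha
  simp only [zero_add, one_mul, hw] at h
  rw [variance_coordGauss ha.le hw]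
  simpa using h

variable {N : ℕ} {α : Fin N → ℝ}

theorem two_mul_variance_sub_le_of_fderiv (hα : ∀ i, 0 ≤ α i)
    {u : EuclideanSpace ℝ (Fin N) → ℝ} (hu : Differentiable ℝ u) {f : growthSpace (Fin N)}
    (hf : ∀ x, f.1 x = u (WithLp.toLp 2 x)) {g : Fin N → growthSpace (Fin N)}
    (hg : ∀ i x, (g i).1 x = fderiv ℝ u (WithLp.toLp 2 x) (EuclideanSpace.single i 1)) {K : ℝ}
    (hfK : ∀ x, |f.1 x| ≤ K) (hgK : ∀ i x, |(g i).1 x| ≤ K) :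
    2 * (∫ x, f.1 x ^ 2 ∂(Measure.pi fun i => coordGauss (α i))
        - (∫ x, f.1 x ∂(Measure.pi fun i => coordGauss (α i))) ^ 2)
      - ∑ i, (∫ x, f.1 x * coordFun (α i) (x i) ∂(Measure.pi fun i => coordGauss (α i))) ^ 2 ≤
      ∑ i, ∫ x, (g i).1 x ^ 2 ∂(Measure.pi fun i => coordGauss (α i)) := by
  refine (isCoordSystem_coordGauss hα).two_mul_variance_sub_le f g fun i x => ?_
  have hK : 0 ≤ K := (abs_nonneg _).trans (hfK 0)
  have hgrow : HasLinearGrowthDeriv (fun t => f.1 (Function.update x i t))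
      fun t => (g i).1 (Function.update x i t) := by
    have hl : ∀ t : ℝ, K ≤ K * (1 + |t|) := fun t =>
      le_mul_of_one_le_right hK (by linarith [abs_nonneg t])
    refine ⟨fun t => ?_, K, fun t => ⟨(hfK _).trans (hl t), (hgK i _).trans (hl t)⟩⟩
    simp only [hf, hg]
    exact hasDerivAt_slice hu i x t
  rw [← mul_sub]
  rcases (hα i).eq_or_lt with h0 | h0
  · simpa only [coordFun, ← h0, if_true] using hgrow.two_mul_variance_sub_le
  · have h1 := hgrow.two_mul_variance_le h0
    simpa [coordFun, h0.ne'] using h1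

end MonomialGaussian

/-- Improved Poincaré inequality with monomial Gaussian weight (second form):
the deficit dominates
`(1/2) ∫ |u − ∫u dμ_A + (∫ux dμ_A)·(∫x dμ_A) − (∫u dμ_A)|∫x dμ_A|²
      − (∫ux dμ_A)·x + (∫u dμ_A)(∫x dμ_A)·x|² dμ_A`. -/
theorem improved_poincare_monomial_gaussian' {N : ℕ} (hN : 1 ≤ N) (α : Fin N → ℝ)
    (hα : ∀ i, 0 ≤ α i) (u : EuclideanSpace ℝ (Fin N) → ℝ) (hu : NstarClass α u) :
    let μ := monGauss α
    let m := ∫ y, u y ∂μ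
    let v : Fin N → ℝ := fun j => ∫ z, u z * z j ∂μ
    let w : Fin N → ℝ := fun j => ∫ z : EuclideanSpace ℝ (Fin N), z j ∂μ
    (∫ x, ‖gradient u x‖ ^ 2 ∂μ) - (∫ x, (u x - m) ^ 2 ∂μ) ≥
      (1 / 2) * ∫ x, (u x - m + (∑ j, v j * w j) - m * (∑ j, (w j) ^ 2)
        - (∑ j, v j * x j) + m * ∑ j, w j * x j) ^ 2 ∂μ := by
  intro μ m v w
  obtain ⟨hsmooth, hsupp, -⟩ := hu
  have hdiff : Differentiable ℝ u := hsmooth.differentiable (by simp)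
  have hcont : Continuous (fderiv ℝ u) := hsmooth.continuous_fderiv (by simp)
  obtain ⟨K, hK⟩ := hsupp.exists_bound_of_continuous hdiff.continuous
  obtain ⟨L, hL⟩ := (hsupp.fderiv ℝ).exists_bound_of_continuous hcont
  have hto : Continuous fun x : Fin N → ℝ => (WithLp.toLp 2 x : EuclideanSpace ℝ (Fin N)) :=
    PiLp.continuous_toLp 2 _
  have hgL : ∀ i x, |fderiv ℝ u x (EuclideanSpace.single i 1)| ≤ L := fun i x => by
    refine ((fderiv ℝ u x).le_opNorm _).trans ?_
    simpa using hL x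
  let f : growthSpace (Fin N) := ⟨fun x => u (WithLp.toLp 2 x), bounded_mem_growthSpace
    (hdiff.continuous.comp hto).measurable fun x => hK _⟩
  let g : Fin N → growthSpace (Fin N) := fun i =>
    ⟨fun x => fderiv ℝ u (WithLp.toLp 2 x) (EuclideanSpace.single i 1), bounded_mem_growthSpace
      ((hcont.comp hto).clm_apply continuous_const).measurable fun x => hgL i _⟩
  have hsys := isCoordSystem_coordGauss hα
  have hprob := hsys.prob
  set P := Measure.pi fun i => coordGauss (α i) with hP
  have hm : ∫ x, f.1 x ∂P = m := (integral_monGauss hα u).symm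
  have hv : ∀ i, ∫ x, f.1 x * x i ∂P = v i := fun i =>
    (integral_monGauss hα fun x => u x * x i).symm
  have hw : ∀ i, ∫ t, t ∂coordGauss (α i) = w i := fun i =>
    (integral_comp_eval (μ := fun i => coordGauss (α i)) (i := i) (f := fun t => t)
      (by fun_prop)).symm.trans (integral_monGauss hα fun x => x i).symm
  have hgrad : ∫ x, ‖gradient u x‖ ^ 2 ∂μ = ∑ i, ∫ x, (g i).1 x ^ 2 ∂P := by
    rw [integral_monGauss hα, ← integral_finsetSum _ fun i _ => hsys.integrable_sq (g i)]
    simp only [norm_gradient_sq_eq_sum]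
    rfl
  have hvar : ∫ x, (u x - m) ^ 2 ∂μ = ∫ x, (f.1 x - m) ^ 2 ∂P :=
    integral_monGauss hα fun x => (u x - m) ^ 2
  have hvar' : ∫ x, (f.1 x - m) ^ 2 ∂P = ∫ x, f.1 x ^ 2 ∂P - m ^ 2 := by
    have hpt : ∀ x, (f.1 x - m) ^ 2 = f.1 x ^ 2 - (2 * m) * f.1 x + m ^ 2 := fun x => by ring
    have i1 := (hsys.integrable_sq f).sub ((hsys.integrable f).const_mul (2 * m))
    simp_rw [hpt]
    rw [integral_add (by exact i1) (integrable_const _), integral_sub (hsys.integrable_sq f)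
      ((hsys.integrable f).const_mul _), integral_const_mul, hm, integral_const, probReal_univ,
      one_smul]
    ring
  have hproj : ∫ x, (u x - m + (∑ j, v j * w j) - m * (∑ j, (w j) ^ 2)
        - (∑ j, v j * x j) + m * ∑ j, w j * x j) ^ 2 ∂μ =
      ∫ x, (f.1 x - m - ∑ i, (v i - m * w i) * (x i - w i)) ^ 2 ∂P := by
    rw [integral_monGauss hα]
    refine integral_congr_ae (ae_of_all _ fun x => ?_)
    simp only
    congr 1
    have hsum : ∑ i, (v i - m * w i) * (x i - w i) =
        ∑ j, v j * x j - ∑ j, v j * w j - m * ∑ j, w j * x j + m * ∑ j, w j ^ 2 := by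
      rw [Finset.mul_sum, Finset.mul_sum, ← Finset.sum_sub_distrib, ← Finset.sum_sub_distrib,
        ← Finset.sum_add_distrib]
      exact Finset.sum_congr rfl fun i _ => by ring
    rw [hsum]
    ring
  have hpyth := hsys.integral_sub_affine_sq f hw (fun i => rfl) hm
    (c := fun i => v i - m * w i) fun i => by rw [hv]
  have hspec := two_mul_variance_sub_le_of_fderiv hα hdiff (f := f) (fun x => rfl) (g := g)
    (fun i x => rfl) (K := max K L) (fun x => (hK _).trans (le_max_left _ _))
    fun i x => (hgL i _).trans (le_max_right _ _)
  have hcoord : ∀ i, (v i - m * w i) ^ 2 * ∫ t, (t - w i) ^ 2 ∂coordGauss (α i) ≤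
      2 * (v i - m * w i) ^ 2 - (∫ x, f.1 x * coordFun (α i) (x i) ∂P) ^ 2 := fun i => by
    rw [← hv i]
    rcases (hα i).eq_or_lt with h0 | h0
    · have hwi := hw i
      rw [← h0, integral_id_coordGauss_zero] at hwi
      simp only [coordFun, ← h0, if_true, ← hwi, sub_zero, integral_sq_coordGauss_zero, mul_zero]
      linarith
    · have h1 := two_mul_variance_coordGauss_le h0 (hw i)
      simp only [coordFun, h0.ne', if_false, mul_zero, integral_zero]
      nlinarith [sq_nonneg (∫ x, f.1 x * x i ∂P - m * w i)]
  have hsum := Finset.sum_le_sum fun i (_ : i ∈ Finset.univ) => hcoord i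
  rw [Finset.sum_sub_distrib, ← Finset.mul_sum] at hsum
  have hpos : 0 ≤ ∫ x, (f.1 x - m - ∑ i, (v i - m * w i) * (x i - w i)) ^ 2 ∂P :=
    integral_nonneg fun x => sq_nonneg _
  rw [hgrad, hvar, hproj]
  rw [← hP, hm] at hspec
  linarith
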